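/- arXiv:1312.7771 — 2 statements merged into one kernel-verified Lean document; each statement's English description precedes it below -/
import Mathlib

section
/- Let d be a square-free positive integer, let K = ℚ(√-d) be the imaginary quadratic field obtained by adjoining a square root of -d to ℚ, and let 𝓞 be the ring of integers of K. Then the set of finite-index subgroups Γ of SL(2,𝓞) whose trace set up to sign equals that of SL(2,𝓞), i.e. {t ∈ 𝓞 : ∃ γ ∈ Γ, tr γ = t or tr γ = -t} = {t ∈ 𝓞 : ∃ γ ∈ SL(2,𝓞), tr γ = t or tr γ = -t}, is infinite. -/
open scoped MatrixGroups
open NumberField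

/-- The trace set up to sign of a subgroup of `SL(2, R)`, as a set of elements of `R`. -/
def traceSetPM {R : Type*} [CommRing R] (H : Subgroup (Matrix.SpecialLinearGroup (Fin 2) R)) :
    Set R :=
  {t : R | ∃ γ ∈ H, Matrix.trace (γ : Matrix (Fin 2) (Fin 2) R) = t ∨
    Matrix.trace (γ : Matrix (Fin 2) (Fin 2) R) = -t}

theorem FreeGroup.exists_finiteIndex_notMem {ι : Type*} {w : FreeGroup ι} (hw : w ≠ 1) :
    ∃ R : Subgroup (FreeGroup ι), R.Normal ∧ R.FiniteIndex ∧ w ∉ R := by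
  classical
  obtain ⟨L, rfl⟩ : ∃ L, FreeGroup.mk L = w := ⟨w.toWord, FreeGroup.mk_toWord⟩
  obtain ⟨B, hfin, hB⟩ : ∃ B : Set (FreeGroup ι), B.Finite ∧ ∀ L', L' <:+ L → FreeGroup.mk L' ∈ B :=
    ⟨{b | b ∈ L.tails.map FreeGroup.mk}, List.finite_toSet _,
      fun L' h => List.mem_map_of_mem ((List.mem_tails _ _).2 h)⟩
  have : Finite B := hfin.to_subtype
  let e (i : ι) : {b : B // FreeGroup.of i * b.1 ∈ B} ≃ {b : B // (FreeGroup.of i)⁻¹ * b.1 ∈ B} :=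
    { toFun := fun b => ⟨⟨_, b.2⟩, by simp⟩
      invFun := fun b => ⟨⟨_, b.2⟩, by simp⟩
      left_inv := fun b => by simp
      right_inv := fun b => by simp }
  let ρ : FreeGroup ι →* Equiv.Perm B := FreeGroup.lift fun i => (e i).extendSubtype
  have key (i : ι) (b : B) (h : FreeGroup.of i * b.1 ∈ B) :
      ρ (FreeGroup.of i) b = ⟨FreeGroup.of i * b.1, h⟩ := by
    simp only [ρ, FreeGroup.lift_apply_of]
    rw [Equiv.extendSubtype_apply_of_mem (e i) b h]
    rfl
  have h1 : (1 : FreeGroup ι) ∈ B := hB [] L.nil_suffix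
  have main : ∀ L', L' <:+ L → (ρ (FreeGroup.mk L') ⟨1, h1⟩ : FreeGroup ι) = FreeGroup.mk L' := by
    intro L'
    induction L' with
    | nil => intro h; rw [← FreeGroup.one_eq_mk, _root_.map_one]; rfl
    | cons p L' ih =>
      intro h
      have h' : L' <:+ L := (List.suffix_cons p L').trans h
      have hmem := hB _ h
      have ih' : ρ (FreeGroup.mk L') ⟨1, h1⟩ = ⟨FreeGroup.mk L', hB L' h'⟩ := Subtype.ext (ih h')
      obtain ⟨i, b⟩ := p
      have hsplit : FreeGroup.mk ((i, b) :: L') = FreeGroup.mk [(i, b)] * FreeGroup.mk L' := by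
        simp
      cases b
      · have hi : FreeGroup.mk [(i, false)] = (FreeGroup.of i)⁻¹ := rfl
        rw [hi] at hsplit
        rw [hsplit] at hmem ⊢
        have : ρ (FreeGroup.of i)⁻¹ ⟨FreeGroup.mk L', hB L' h'⟩ = ⟨_, hmem⟩ := by
          rw [_root_.map_inv, Equiv.Perm.inv_eq_iff_eq, key]
          · simp
          · simpa using hB L' h'
        rw [_root_.map_mul, Equiv.Perm.mul_apply, ih', this]
      · have hi : FreeGroup.mk [(i, true)] = FreeGroup.of i := rfl
        rw [hi] at hsplit
        rw [hsplit] at hmem ⊢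
        rw [_root_.map_mul, Equiv.Perm.mul_apply, ih', key _ _ hmem]
  refine ⟨ρ.ker, inferInstance, inferInstance, fun h => hw ?_⟩
  have := main L List.suffix_rfl
  rw [MonoidHom.mem_ker.1 h] at this
  exact this.symm

theorem FreeGroup.exists_finiteIndex_disjoint {ι : Type*} {S : Set (FreeGroup ι)} (hS : S.Finite)
    (h1 : 1 ∉ S) :
    ∃ R : Subgroup (FreeGroup ι), R.Normal ∧ R.FiniteIndex ∧ ∀ w ∈ S, w ∉ R := by
  induction S, hS using Set.Finite.induction_on with
  | empty => exact ⟨⊤, inferInstance, inferInstance, by simp⟩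
  | @insert a S ha hS ih =>
    obtain ⟨R, h, h', hR⟩ := ih fun h => h1 (Set.mem_insert_of_mem _ h)
    obtain ⟨T, k, k', hT⟩ := FreeGroup.exists_finiteIndex_notMem
      (w := a) (fun h => h1 (h ▸ Set.mem_insert _ _))
    refine ⟨R ⊓ T, inferInstance, inferInstance, ?_⟩
    rintro w (rfl | hw) hmem
    · exact hT hmem.2
    · exact hR w hw hmem.1

theorem FreeGroup.exists_finiteIndex_lt_orderOf {ι : Type*} {S : Set (FreeGroup ι)} (hS : S.Finite)
    (h1 : 1 ∉ S) (n : ℕ) :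
    ∃ (R : Subgroup (FreeGroup ι)) (_ : R.Normal), R.FiniteIndex ∧
      ∀ w ∈ S, n < orderOf (w : FreeGroup ι ⧸ R) := by
  obtain ⟨R, hN, hF, hR⟩ := FreeGroup.exists_finiteIndex_disjoint
    (S := (fun p : FreeGroup ι × ℕ => p.1 ^ p.2) '' (S ×ˢ Set.Icc 1 n))
    ((hS.prod (Set.finite_Icc _ _)).image _) (by
      rintro ⟨⟨w, j⟩, ⟨hw, hj⟩, h⟩
      have hj' : j ≠ 0 := by simp only [Set.mem_Icc] at hj; omega
      exact h1 ((pow_eq_one_iff_left hj').1 h ▸ hw))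
  refine ⟨R, hN, hF, fun w hw => ?_⟩
  by_contra! hle
  have hpos : 0 < orderOf (w : FreeGroup ι ⧸ R) := orderOf_pos _
  refine hR _ ⟨(w, orderOf (w : FreeGroup ι ⧸ R)), ⟨hw, hpos, hle⟩, rfl⟩ ?_
  rw [← QuotientGroup.eq_one_iff]
  simp only [QuotientGroup.mk_pow]
  exact pow_orderOf_eq_one _

theorem FreeGroup.exists_cocycle {ι A M : Type*} [Group A] [AddCommGroup M]
    (π : FreeGroup ι →* A) (u : ι → A → M) :
    ∃ b : FreeGroup ι → A → M, (∀ f g x, b (f * g) x = b f x + b g (x * π f)) ∧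
      ∀ i, b (FreeGroup.of i) = u i := by
  let P (i : ι) : Equiv.Perm (A × M) :=
    { toFun := fun p => (p.1 * π (FreeGroup.of i), p.2 + u i p.1)
      invFun := fun p => (p.1 * (π (FreeGroup.of i))⁻¹, p.2 - u i (p.1 * (π (FreeGroup.of i))⁻¹))
      left_inv := fun p => by simp
      right_inv := fun p => by simp }
  let θ : FreeGroup ι →* Equiv.Perm (A × M) := FreeGroup.lift fun i => (P i)⁻¹
  have hθ (f : FreeGroup ι) : ∀ x c, θ f (x, c) = (x * (π f)⁻¹, c + (θ f (x, 0)).2) := by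
    induction f using FreeGroup.induction_on with
    | C1 => simp
    | of i =>
      intro x c
      simp [θ, Equiv.Perm.inv_def, P, sub_eq_add_neg]
    | inv_of i _ =>
      intro x c
      simp [θ, P]
    | mul f g hf hg =>
      intro x c
      simp only [_root_.map_mul, Equiv.Perm.mul_apply]
      rw [hg, hf, hg x 0, hf _ (0 + _)]
      simp [mul_assoc, add_assoc]
  refine ⟨fun f x => (θ f⁻¹ (x, 0)).2, fun f g x => ?_, fun i => ?_⟩
  · simp only [mul_inv_rev, _root_.map_mul, Equiv.Perm.mul_apply]
    rw [hθ f⁻¹, hθ g⁻¹]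
    simp
  · ext x
    simp [θ, P]

/-- Given finitely many elements `s` of a free group of rank two which have large order modulo
a normal subgroup `R` of index `m`, there is a nontrivial homomorphism from `R` to `k`
killing all conjugates of the elements `s ^ m`. -/
theorem FreeGroup.exists_hom_ne_one {R : Subgroup (FreeGroup Bool)} [R.Normal] [R.FiniteIndex]
    (k : Type*) [Field k] (S : Finset (FreeGroup Bool))
    (hS : ∀ s ∈ S, S.card < orderOf (s : FreeGroup Bool ⧸ R)) :
    ∃ ψ : R →* Multiplicative k, ψ ≠ 1 ∧
      ∀ s ∈ S, ∀ f, ∃ h : f * s ^ R.index * f⁻¹ ∈ R, ψ ⟨_, h⟩ = 1 := by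
  classical
  let A := FreeGroup Bool ⧸ R
  let π : FreeGroup Bool →* A := QuotientGroup.mk' R
  have : Finite A := inferInstance
  have := Fintype.ofFinite A
  obtain ⟨b, hb, hbi⟩ := FreeGroup.exists_cocycle (M := Module.Dual k (Bool → A → k)) π
    (fun i x => LinearMap.proj x ∘ₗ LinearMap.proj (φ := fun _ => A → k) i)
  have hb1 (x) : b 1 x = 0 := by simpa using hb 1 1 x
  have hinv (f x) : b f⁻¹ (x * π f) = - b f x := by
    have := hb f f⁻¹ x
    rw [mul_inv_cancel, hb1] at this
    exact (neg_eq_of_add_eq_zero_right this.symm).symm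
  have hcomm (s : FreeGroup Bool) (x) :
      b (s ^ orderOf (π s)) (x * π s) = b (s ^ orderOf (π s)) x := by
    have h1 := hb s (s ^ orderOf (π s)) x
    have h2 := hb (s ^ orderOf (π s)) s x
    rw [map_pow, pow_orderOf_eq_one, mul_one, ← pow_succ, pow_succ', h1, add_comm] at h2
    exact add_right_cancel h2
  have hpow (s : FreeGroup Bool) (n : ℕ) (x) :
      b (s ^ (orderOf (π s) * n)) x = n • b (s ^ orderOf (π s)) x := by
    induction n with
    | zero => simp [hb1]
    | succ n ih =>
      rw [Nat.mul_succ, pow_add, hb, ih, map_pow, pow_mul, pow_orderOf_eq_one, one_pow, mul_one,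
        succ_nsmul]
  have hzpow (s : FreeGroup Bool) (x y : A) (hy : y ∈ Subgroup.zpowers (π s)) :
      b (s ^ orderOf (π s)) (x * y) = b (s ^ orderOf (π s)) x := by
    have : Finite A := inferInstance
    obtain ⟨n, rfl⟩ := (mem_powers_iff_mem_zpowers (x := π s)).2 hy
    induction n with
    | zero => simp
    | succ n ih =>
      simp only at ih ⊢
      rw [pow_succ, ← mul_assoc, hcomm, ih]
      exact (mem_powers_iff_mem_zpowers (x := π s)).1 ⟨n, rfl⟩
  let Ψ : (Bool → A → k) →ₗ[k] ((Σ s : S, A ⧸ Subgroup.zpowers (π s)) → k) :=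
    LinearMap.pi fun p => b ((p.1 : FreeGroup Bool) ^ orderOf (π p.1)) p.2.out
  let D : (A → k) →ₗ[k] (Bool → A → k) :=
    { toFun := fun v i x => v (x * π (FreeGroup.of i)) - v x
      map_add' := fun v w => by ext i x; simp; abel
      map_smul' := fun c v => by ext i x; simp [mul_sub] }
  have hdim : Module.finrank k (LinearMap.range D) < Module.finrank k (LinearMap.ker Ψ) := by
    have h1 := LinearMap.finrank_range_le D
    have h2 := LinearMap.finrank_range_add_finrank_ker Ψ
    have h3 := Submodule.finrank_le (LinearMap.range Ψ)
    have h4 : Module.finrank k (Bool → A → k) = 2 * Fintype.card A := by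
      simp [Module.finrank_pi_fintype]
    have h5 : Module.finrank k (A → k) = Fintype.card A := by simp
    have h6 : Module.finrank k ((Σ s : S, A ⧸ Subgroup.zpowers (π s)) → k) < Fintype.card A := by
      rw [Module.finrank_fintype_fun_eq_card, Fintype.card_sigma]
      have h7 (s : S) :
          Fintype.card (A ⧸ Subgroup.zpowers (π s)) * (S.card + 1) ≤ Fintype.card A := by
        have := Subgroup.card_eq_card_quotient_mul_card_subgroup (Subgroup.zpowers (π s))
        rw [Nat.card_zpowers, Nat.card_eq_fintype_card, Nat.card_eq_fintype_card] at this
        rw [this]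
        exact Nat.mul_le_mul_left _ (hS s s.2)
      have h8 := Finset.sum_le_sum fun s (_ : s ∈ (Finset.univ : Finset S)) => h7 s
      rw [← Finset.sum_mul] at h8
      simp only [Finset.sum_const, Finset.card_univ, Fintype.card_coe, smul_eq_mul] at h8
      have h9 : 0 < Fintype.card A := Fintype.card_pos
      by_contra! h10
      nlinarith
    omega
  obtain ⟨u, hu, huD⟩ : ∃ u ∈ LinearMap.ker Ψ, u ∉ LinearMap.range D := by
    by_contra! h
    exact hdim.not_ge (Submodule.finrank_mono h)
  have hvan (s) (hs : s ∈ S) (x : A) : b (s ^ R.index) x u = 0 := by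
    have h0 : b (s ^ orderOf (π s)) x u = 0 := by
      have h1 := congrFun (LinearMap.mem_ker.1 hu) ⟨⟨s, hs⟩, (x : A ⧸ Subgroup.zpowers (π s))⟩
      simp only [Ψ, LinearMap.pi_apply, Pi.zero_apply] at h1
      obtain ⟨y, hy⟩ := QuotientGroup.mk_out_eq_mul (Subgroup.zpowers (π s)) x
      rwa [hy, hzpow _ _ _ y.2] at h1
    obtain ⟨n, hn⟩ : orderOf (π s) ∣ R.index := orderOf_dvd_natCard _
    rw [hn, hpow, LinearMap.smul_apply, h0, smul_zero]
  have hπ (r) (hr : r ∈ R) : π r = 1 := (QuotientGroup.eq_one_iff r).2 hr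
  obtain ⟨r, x, hr, hrx⟩ : ∃ r, ∃ x, r ∈ R ∧ b r x u ≠ 0 := by
    by_contra! h
    refine huD ⟨fun y => b (Quotient.out y) 1 u, ?_⟩
    have hv (f) : b (Quotient.out (π f)) 1 u = b f 1 u := by
      obtain ⟨y, hy⟩ := QuotientGroup.mk_out_eq_mul R f
      change b (Quotient.out (f : A)) 1 u = _
      rw [hy, hb, LinearMap.add_apply, h _ _ y.2, add_zero]
    ext i x
    obtain ⟨f, rfl⟩ := QuotientGroup.mk'_surjective R x
    change b (Quotient.out (π f * π (FreeGroup.of i))) 1 u - b (Quotient.out (π f)) 1 u = u i (π f)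
    rw [← _root_.map_mul, hv, hv, hb, LinearMap.add_apply, hbi]
    simp
  refine ⟨{
    toFun := fun r => Multiplicative.ofAdd (b r x u)
    map_one' := by simp [hb1]
    map_mul' := ?_ }, ?_, ?_⟩
  · intro r t
    rw [Subgroup.coe_mul, hb, hπ r r.2, mul_one, LinearMap.add_apply, ofAdd_add]
  · intro h
    exact hrx (Multiplicative.ofAdd.injective (DFunLike.congr_fun h ⟨r, hr⟩))
  · intro s hs f
    have hsm : π (s ^ R.index) = 1 := by
      rw [map_pow]
      exact pow_card_eq_one'
    refine ⟨(QuotientGroup.eq_one_iff _).1 ?_, ?_⟩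
    · change π _ = 1
      rw [_root_.map_mul, _root_.map_mul, hsm, mul_one, _root_.map_inv, mul_inv_cancel]
    · change Multiplicative.ofAdd (b (f * s ^ R.index * f⁻¹) x u) = Multiplicative.ofAdd 0
      rw [hb, hb, _root_.map_mul, hsm, mul_one, hinv]
      simp [hvan s hs]

/-- If `u` lies in an abelian normal subgroup of prime exponent `q` and `(u * s) ^ k = s ^ k = 1`
with `k` prime to `q`, then `u * s` and `s` are conjugate. -/
theorem Subgroup.exists_mul_eq_conj {G : Type*} [Group G] {U : Subgroup G} [U.Normal]
    (hcomm : ∀ x ∈ U, ∀ y ∈ U, x * y = y * x) {q : ℕ} (hq : q.Prime) (hexp : ∀ x ∈ U, x ^ q = 1)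
    {u s : G} (hu : u ∈ U) {k : ℕ} (hk : ¬ q ∣ k) (hus : (u * s) ^ k = 1) (hs : s ^ k = 1) :
    ∃ p, u * s = p * s * p⁻¹ := by
  have hconj (x) (hx : x ∈ U) : s * x * s⁻¹ ∈ U := Subgroup.Normal.conj_mem inferInstance x hx s
  have key (i : ℕ) : (u * s) ^ i * (s ^ i)⁻¹ ∈ U ∧
      ∃ P ∈ U, s * P * s⁻¹ * u ^ i = P * ((u * s) ^ i * (s ^ i)⁻¹) := by
    induction i with
    | zero => exact ⟨by simp, 1, U.one_mem, by simp⟩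
    | succ i ih =>
      obtain ⟨hn, P, hP, h⟩ := ih
      set n := (u * s) ^ i * (s ^ i)⁻¹ with hn'
      have hsucc : (u * s) ^ (i + 1) * (s ^ (i + 1))⁻¹ = u * (s * n * s⁻¹) := by
        rw [hn', pow_succ', pow_succ]; group
      rw [hsucc]
      refine ⟨U.mul_mem hu (hconj n hn), P * n, U.mul_mem hP hn, ?_⟩
      calc s * (P * n) * s⁻¹ * u ^ (i + 1)
          = s * P * s⁻¹ * ((s * n * s⁻¹) * u ^ i) * u := by rw [pow_succ]; group
        _ = (s * P * s⁻¹ * u ^ i) * ((s * n * s⁻¹) * u) := by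
            rw [hcomm _ (hconj n hn) _ (U.pow_mem hu i)]; group
        _ = P * n * (u * (s * n * s⁻¹)) := by rw [h, hcomm _ (hconj n hn) _ hu]
  obtain ⟨-, P, hP, h⟩ := key k
  rw [hus, hs, inv_one, mul_one, mul_one] at h
  have huk : u ^ k = P * (s * P⁻¹ * s⁻¹) := by
    rw [hcomm _ hP _ (hconj _ (U.inv_mem hP))]
    calc u ^ k = (s * P * s⁻¹)⁻¹ * (s * P * s⁻¹ * u ^ k) := by group
      _ = _ := by rw [h]; group
  obtain ⟨e, -, he⟩ := Nat.exists_mul_mod_eq_one_of_coprime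
    ((Nat.Prime.coprime_iff_not_dvd hq).2 hk).symm hq.one_lt
  have hue : u = (u ^ k) ^ e := by
    rw [← pow_mul, ← Nat.div_add_mod (k * e) q, he, pow_succ, pow_mul, hexp u hu]
    simp
  refine ⟨P ^ e, ?_⟩
  have hcomm' : Commute P (s * P⁻¹ * s⁻¹) := hcomm _ hP _ (hconj _ (U.inv_mem hP))
  have h2 : (s * P⁻¹ * s⁻¹) ^ e = s * (P ^ e)⁻¹ * s⁻¹ := by rw [conj_pow, inv_pow]
  rw [huk, hcomm'.mul_pow, h2] at hue
  nth_rewrite 1 [hue]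
  group

theorem Subgroup.exists_index_eq_card_and_conj_mem {G : Type*} [Group G] [Finite G]
    {U : Subgroup G} [U.Normal] (hcomm : ∀ x ∈ U, ∀ y ∈ U, x * y = y * x) {q : ℕ} (hq : q.Prime)
    (hexp : ∀ x ∈ U, x ^ q = 1) (hindex : ¬ q ∣ U.index) :
    ∃ H : Subgroup G, H.index = Nat.card U ∧
      ∀ (t : G) (k : ℕ), ¬ q ∣ k → t ^ k = 1 → ∃ g, g * t * g⁻¹ ∈ H := by
  have := Fact.mk hq
  have hU : IsPGroup q U := fun x => ⟨1, by ext; simpa using hexp x x.2⟩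
  obtain ⟨n, hn⟩ := IsPGroup.iff_card.1 hU
  have hco : Nat.Coprime (Nat.card U) U.index := by
    rw [hn]
    exact Nat.Coprime.pow_left n ((Nat.Prime.coprime_iff_not_dvd hq).2 hindex)
  obtain ⟨H, hH⟩ := Subgroup.exists_right_complement'_of_coprime hco
  refine ⟨H, hH.index_eq_card, fun t k hk ht => ?_⟩
  obtain ⟨⟨⟨u, hu⟩, ⟨s, hs⟩⟩, rfl : u * s = t⟩ := hH.2 t
  have hmk : (s : G ⧸ U) = ((u * s : G) : G ⧸ U) := by
    rw [QuotientGroup.mk_mul, (QuotientGroup.eq_one_iff u).2 hu, one_mul]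
  have hsk : s ^ k = 1 := by
    have : s ^ k ∈ U := by
      rw [← QuotientGroup.eq_one_iff, QuotientGroup.mk_pow, hmk, ← QuotientGroup.mk_pow, ht]
      rfl
    exact Subgroup.disjoint_def.1 hH.disjoint this (H.pow_mem hs k)
  obtain ⟨p, hp⟩ := Subgroup.exists_mul_eq_conj hcomm hq hexp hu hk ht hsk
  refine ⟨p⁻¹, ?_⟩
  rw [hp]
  convert SetLike.mem_coe.1 hs using 1
  group

theorem Subgroup.exists_dvd_index_and_conj_mem {G : Type*} [Group G] {Γ : Subgroup G}
    [Γ.FiniteIndex] {q : ℕ} [Fact q.Prime] {χ : Γ →* Multiplicative (ZMod q)} (hχ : χ ≠ 1)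
    (hindex : ¬ q ∣ Γ.normalCore.index) :
    ∃ H : Subgroup G, H.FiniteIndex ∧ q ∣ H.index ∧ ∀ (t : G) (k : ℕ), ¬ q ∣ k →
      t ^ k ∈ (χ.ker.map Γ.subtype).normalCore → ∃ g, g * t * g⁻¹ ∈ H := by
  have hq : q.Prime := Fact.out
  have : NeZero q := ⟨hq.ne_zero⟩
  have : Finite (Multiplicative (ZMod q)) := inferInstanceAs (Finite (ZMod q))
  have hfin : (χ.ker.map Γ.subtype).FiniteIndex :=
    ⟨by
      rw [Subgroup.index_map_subtype]
      exact mul_ne_zero FiniteIndex.index_ne_zero FiniteIndex.index_ne_zero⟩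
  set N := (χ.ker.map Γ.subtype).normalCore with hN
  have hNmem (g : G) (h : ∀ b : G, ∃ hb : b * g * b⁻¹ ∈ Γ, χ ⟨_, hb⟩ = 1) : g ∈ N := fun b =>
    let ⟨hb, hb'⟩ := h b
    ⟨⟨_, hb⟩, hb', rfl⟩
  have hle : N ≤ Γ.normalCore := Subgroup.normalCore_mono (Subgroup.map_subtype_le _)
  have : Finite (G ⧸ N) := inferInstance
  let U := Γ.normalCore.map (QuotientGroup.mk' N)
  have hUN : U.Normal := Subgroup.Normal.map inferInstance _ (QuotientGroup.mk'_surjective N)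
  have hUi : U.index = Γ.normalCore.index :=
    Subgroup.index_map_eq _ (QuotientGroup.mk'_surjective N) (by simpa using hle)
  have hpow (x : Multiplicative (ZMod q)) : x ^ q = 1 := by
    simpa [Nat.card_zmod] using pow_card_eq_one' (x := x)
  have hexp : ∀ x ∈ U, x ^ q = 1 := by
    rintro _ ⟨g, hg, rfl⟩
    rw [← map_pow]
    refine (QuotientGroup.eq_one_iff _).2 (hNmem _ fun b => ?_)
    rw [← conj_pow]
    refine ⟨Γ.pow_mem (hg b) q, ?_⟩
    exact (map_pow χ ⟨_, hg b⟩ q).trans (hpow _)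
  have hcomm : ∀ x ∈ U, ∀ y ∈ U, x * y = y * x := by
    rintro _ ⟨g, hg, rfl⟩ _ ⟨h, hh, rfl⟩
    rw [← map_mul, ← map_mul]
    refine QuotientGroup.eq.2 (hNmem _ fun b => ?_)
    have hb : b * ((g * h)⁻¹ * (h * g)) * b⁻¹ =
        ((⟨_, hg b⟩ * ⟨_, hh b⟩)⁻¹ * (⟨_, hh b⟩ * ⟨_, hg b⟩) : Γ) := by
      push_cast
      group
    simp only [hb]
    refine ⟨SetLike.coe_mem _, ?_⟩
    simp only [Subtype.coe_eta, map_mul, map_inv]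
    rw [mul_comm (χ _) (χ _), inv_mul_cancel]
  have hcard : q ∣ Nat.card U := by
    have hU : IsPGroup q U := fun x => ⟨1, by ext; simpa using hexp x x.2⟩
    obtain ⟨n, hn⟩ := IsPGroup.iff_card.1 hU
    obtain ⟨γ, hγ⟩ : ∃ γ, χ γ ≠ 1 := by
      by_contra! h
      exact hχ (MonoidHom.ext h)
    rcases n with - | n
    · exfalso
      rw [pow_zero, Subgroup.card_eq_one] at hn
      have h1 : QuotientGroup.mk' N ((γ : G) ^ Γ.normalCore.index) ∈ U :=
        ⟨_, Subgroup.pow_index_mem _ _, rfl⟩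
      rw [hn, Subgroup.mem_bot] at h1
      obtain ⟨x, hx, hx'⟩ := Subgroup.normalCore_le _ ((QuotientGroup.eq_one_iff _).1 h1)
      have hx2 : x = γ ^ Γ.normalCore.index := Subtype.ext hx'
      rw [hx2] at hx
      have h2 : χ γ ^ Γ.normalCore.index = 1 := by rw [← map_pow]; exact hx
      exact hindex (orderOf_eq_prime (hpow _) hγ ▸ orderOf_dvd_of_pow_eq_one h2)
    · exact ⟨q ^ n, by rw [hn, pow_succ']⟩
  obtain ⟨H, hH, hconj⟩ := Subgroup.exists_index_eq_card_and_conj_mem hcomm hq hexp (hUi ▸ hindex)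
  have hind : (H.comap (QuotientGroup.mk' N)).index = H.index :=
    Subgroup.index_comap_of_surjective _ (QuotientGroup.mk'_surjective N)
  refine ⟨H.comap (QuotientGroup.mk' N), ⟨?_⟩, ?_, fun t k hk ht => ?_⟩
  · rw [hind, hH]
    exact Nat.card_pos.ne'
  · rwa [hind, hH]
  · obtain ⟨g, hg⟩ := hconj (QuotientGroup.mk' N t) k hk
      (by rw [← map_pow]; exact (QuotientGroup.eq_one_iff _).2 ht)
    obtain ⟨g, rfl⟩ := QuotientGroup.mk'_surjective N g
    exact ⟨g, by simpa using hg⟩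

/-- Suppose that a finite index normal subgroup `Γ` of `G` surjects onto a free group of rank two.
If the elements of `T` take finitely many values up to elements which, together with all their
conjugates, are killed by this surjection, then infinitely many subgroups of finite index
contain a conjugate of every element of `T`. -/
theorem Subgroup.infinite_finiteIndex_conj_mem {G : Type*} [Group G] {Γ : Subgroup G}
    [Γ.Normal] [Γ.FiniteIndex] {Φ : Γ →* FreeGroup Bool} (hΦ : Function.Surjective Φ)
    {T I : Set G} (hI : I.Finite)
    (hT : ∀ t ∈ T, ∃ κ, ∃ h ∈ I, t = κ * h ∧ ∀ g, ∃ hκ : g * κ * g⁻¹ ∈ Γ, Φ ⟨_, hκ⟩ = 1) :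
    {H : Subgroup G | H.FiniteIndex ∧ ∀ t ∈ T, ∃ g, g * t * g⁻¹ ∈ H}.Infinite := by
  classical
  have hΓpow (h g : G) : g * h ^ Γ.index * g⁻¹ ∈ Γ :=
    Subgroup.Normal.conj_mem inferInstance _ (Γ.pow_index_mem h) g
  have := hI.to_subtype
  have hfin : (Set.range fun p : I × (G ⧸ Γ) => Φ ⟨_, hΓpow p.1 p.2.out⟩).Finite :=
    Set.finite_range _
  let S := hfin.toFinset.erase 1
  obtain ⟨R, hRn, hRf, hR⟩ := FreeGroup.exists_finiteIndex_lt_orderOf S.finite_toSet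
    (by simp [S]) S.card
  let Γ₁ := (R.comap Φ).map Γ.subtype
  have hΓ₁ : Γ₁.FiniteIndex := ⟨by
    rw [Subgroup.index_map_subtype, Subgroup.index_comap_of_surjective _ hΦ]
    exact mul_ne_zero FiniteIndex.index_ne_zero FiniteIndex.index_ne_zero⟩
  have hmem₁ (x : Γ) : (x : G) ∈ Γ₁ ↔ Φ x ∈ R :=
    ⟨fun ⟨y, hy, hyx⟩ => Subtype.ext hyx ▸ hy, fun hx => ⟨x, hx, rfl⟩⟩
  have hle₁ : Γ₁ ≤ Γ := Subgroup.map_subtype_le _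
  refine Set.Infinite.of_image Subgroup.index (Set.infinite_of_forall_exists_gt fun n => ?_)
  obtain ⟨q, hqn, hq⟩ :=
    Nat.exists_infinite_primes (n + Γ.index + R.index + Γ₁.normalCore.index + 1)
  have := Fact.mk hq
  obtain ⟨ψ, hψ, hψS⟩ := FreeGroup.exists_hom_ne_one (ZMod q) S hR
  let χ : Γ₁ →* Multiplicative (ZMod q) :=
    { toFun := fun x => ψ ⟨Φ ⟨x, hle₁ x.2⟩, (hmem₁ ⟨x, hle₁ x.2⟩).1 x.2⟩
      map_one' := by rw [← map_one ψ]; congr 1; ext1; exact map_one Φ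
      map_mul' := fun x y => by rw [← map_mul ψ]; congr 1; ext1; exact map_mul Φ ⟨x, _⟩ ⟨y, _⟩ }
  have hχ : χ ≠ 1 := by
    contrapose! hψ
    refine MonoidHom.ext fun r => ?_
    obtain ⟨x, hx⟩ := hΦ r
    have hx' : Φ x ∈ R := hx ▸ r.2
    refine Eq.trans (congrArg ψ ?_) (DFunLike.congr_fun hψ ⟨x, (hmem₁ x).2 hx'⟩)
    exact Subtype.ext hx.symm
  have hker (x : Γ) (hx : ∃ h : Φ x ∈ R, ψ ⟨Φ x, h⟩ = 1) :
      (x : G) ∈ χ.ker.map Γ₁.subtype := by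
    obtain ⟨h, hx⟩ := hx
    exact ⟨⟨x, (hmem₁ x).2 h⟩, hx, rfl⟩
  have hndvd (i : ℕ) (h0 : i ≠ 0) (hi : i < q) : ¬ q ∣ i :=
    Nat.not_dvd_of_pos_of_lt (Nat.pos_of_ne_zero h0) hi
  have hΓi : Γ.index ≠ 0 := FiniteIndex.index_ne_zero
  have hRi : R.index ≠ 0 := FiniteIndex.index_ne_zero
  obtain ⟨H, hH, hdvd, hconj⟩ := Subgroup.exists_dvd_index_and_conj_mem hχ
    (hndvd _ FiniteIndex.index_ne_zero (by omega))
  refine ⟨H.index, ⟨H, ⟨hH, fun t ht => ?_⟩, rfl⟩, ?_⟩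
  swap
  · have := Nat.le_of_dvd (Nat.pos_of_ne_zero FiniteIndex.index_ne_zero) hdvd
    omega
  refine hconj t (Γ.index * R.index) (fun h => ?_) ?_
  · rcases hq.dvd_mul.1 h with h | h
    · exact hndvd _ hΓi (by omega) h
    · exact hndvd _ hRi (by omega) h
  obtain ⟨κ, h, hh, rfl, hκ⟩ := hT t ht
  set N := (χ.ker.map Γ₁.subtype).normalCore
  have hκN : κ ∈ N := fun g => by
    obtain ⟨hg, h1⟩ := hκ g
    exact hker ⟨_, hg⟩ ⟨by rw [h1]; exact R.one_mem, by simp only [h1]; exact map_one ψ⟩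
  suffices h ^ (Γ.index * R.index) ∈ N by
    rw [← QuotientGroup.eq_one_iff] at hκN this ⊢
    rwa [QuotientGroup.mk_pow, QuotientGroup.mk_mul, hκN, one_mul, ← QuotientGroup.mk_pow]
  intro g
  obtain ⟨γ, hγ⟩ := QuotientGroup.mk_out_eq_mul Γ g
  let γ' : Γ := ⟨g * γ * g⁻¹, Subgroup.Normal.conj_mem inferInstance _ γ.2 g⟩
  let x : Γ := ⟨_, hΓpow h (g : G ⧸ Γ).out⟩
  have hx : g * h ^ (Γ.index * R.index) * g⁻¹ = (γ'⁻¹ * x ^ R.index * γ' : Γ) := by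
    simp only [γ', x, Subgroup.coe_mul, Subgroup.coe_pow, Subgroup.coe_inv, hγ, conj_pow, pow_mul]
    group
  rw [hx]
  apply hker
  have hΦx : Φ (γ'⁻¹ * x ^ R.index * γ') = (Φ γ')⁻¹ * Φ x ^ R.index * (Φ γ')⁻¹⁻¹ := by
    simp only [map_mul, map_inv, map_pow, inv_inv]
  simp only [hΦx]
  by_cases hs : Φ x = 1
  · have h1 : (Φ γ')⁻¹ * Φ x ^ R.index * (Φ γ')⁻¹⁻¹ = 1 := by rw [hs]; group
    simp only [h1]
    exact ⟨R.one_mem, map_one ψ⟩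
  · exact hψS _ (by
      simp only [S, Finset.mem_erase, Set.Finite.mem_toFinset]
      exact ⟨hs, ⟨(⟨h, hh⟩, g), rfl⟩⟩) _

section DescProd

variable {V F : Type*} [PartialOrder V] [Group F]

/-- `l` lists the elements of `S` in strictly decreasing order. -/
def IsDescListing (l : List V) (S : Set V) : Prop :=
  l.Pairwise (· > ·) ∧ ∀ v, v ∈ l ↔ v ∈ S

theorem IsDescListing.unique {l l' : List V} {S : Set V} (h : IsDescListing l S)
    (h' : IsDescListing l' S) : l = l' := by
  have hn {l : List V} (h : l.Pairwise (· > ·)) : l.Nodup := h.imp fun h => h.ne'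
  refine List.Perm.eq_of_pairwise (le := (· > ·)) (fun a b _ _ h1 h2 => (lt_asymm h1 h2).elim)
    h.1 h'.1 ((List.perm_ext_iff_of_nodup (hn h.1) (hn h'.1)).2 fun v => ?_)
  rw [h.2, h'.2]

theorem IsDescListing.append {l m : List V} {S T : Set V} (hl : IsDescListing l S)
    (hm : IsDescListing m T) (h : ∀ v ∈ S, ∀ w ∈ T, w < v) : IsDescListing (l ++ m) (S ∪ T) :=
  ⟨List.pairwise_append.2 ⟨hl.1, hm.1, fun v hv w hw => h v ((hl.2 v).1 hv) w ((hm.2 w).1 hw)⟩,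
    fun v => by rw [List.mem_append, hl.2, hm.2, Set.mem_union]⟩

theorem exists_isDescListing {S : Set V} (hS : S.Finite) (hc : IsChain (· ≤ ·) S) :
    ∃ l, IsDescListing l S := by
  induction hn : S.ncard generalizing S with
  | zero => exact ⟨[], List.Pairwise.nil, by simp [(Set.ncard_eq_zero hS).1 hn]⟩
  | succ n ih =>
    have hne : S.Nonempty := Set.nonempty_of_ncard_ne_zero (by omega)
    obtain ⟨a, ha⟩ := hS.exists_maximal hne
    have hsub : S \ {a} ⊆ S := Set.sdiff_subset
    obtain ⟨l, hl⟩ := ih (hS.subset hsub) (hc.mono hsub)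
      (by rw [Set.ncard_sdiff_singleton_of_mem ha.1, hn]; rfl)
    have := IsDescListing.append (l := [a]) (S := {a}) ⟨by simp, by simp⟩ hl (by
      rintro _ rfl w ⟨hw, hwa⟩
      refine lt_of_le_of_ne ?_ hwa
      exact (hc.total hw ha.1).elim id fun h => ha.2 hw h)
    rw [Set.union_sdiff_cancel (by simpa using ha.1)] at this
    exact ⟨_, this⟩

open Classical in
/-- The product of the labels `s v` over the elements `v` of a finite chain, taken in decreasing
order (and `1` if `S` is not a finite chain). -/
noncomputable def descProd (s : V → F) (S : Set V) : F :=
  if h : ∃ l, IsDescListing l S then (h.choose.map s).prod else 1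

theorem IsDescListing.descProd_eq {s : V → F} {l : List V} {S : Set V} (h : IsDescListing l S) :
    descProd s S = (l.map s).prod := by
  have h' : ∃ l, IsDescListing l S := ⟨l, h⟩
  rw [descProd, dif_pos h', h'.choose_spec.unique h]

theorem descProd_empty (s : V → F) : descProd s ∅ = 1 :=
  IsDescListing.descProd_eq (l := []) ⟨List.Pairwise.nil, by simp⟩

theorem descProd_singleton (s : V → F) (v : V) : descProd s {v} = s v := by
  rw [IsDescListing.descProd_eq (l := [v]) ⟨by simp, by simp⟩]
  simp

theorem descProd_union {s : V → F} {S T : Set V} (hS : (S ∪ T).Finite)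
    (hc : IsChain (· ≤ ·) (S ∪ T)) (h : ∀ v ∈ S, ∀ w ∈ T, ¬ v ≤ w) :
    descProd s (S ∪ T) = descProd s S * descProd s T := by
  obtain ⟨l, hl⟩ := exists_isDescListing (hS.subset Set.subset_union_left)
    (hc.mono Set.subset_union_left)
  obtain ⟨m, hm⟩ := exists_isDescListing (hS.subset Set.subset_union_right)
    (hc.mono Set.subset_union_right)
  have := hl.append hm fun v hv w hw =>
    ((hc.total (Or.inl hv) (Or.inr hw)).resolve_left (h v hv w hw)).lt_of_not_ge (h v hv w hw)
  rw [this.descProd_eq, hl.descProd_eq, hm.descProd_eq, List.map_append, List.prod_append]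

theorem descProd_image {s : V → F} {S : Set V} (hS : S.Finite) (hc : IsChain (· ≤ ·) S)
    {f : V → V} (hf : StrictMono f) (hs : ∀ v ∈ S, s (f v) = s v) :
    descProd s (f '' S) = descProd s S := by
  obtain ⟨l, hl⟩ := exists_isDescListing hS hc
  have hl' : IsDescListing (l.map f) (f '' S) :=
    ⟨List.pairwise_map.2 (hl.1.imp fun h => hf h), fun v => by simp [hl.2]⟩
  rw [hl.descProd_eq, hl'.descProd_eq, List.map_map]
  exact congrArg List.prod (List.map_congr_left fun v hv => hs v ((hl.2 v).1 hv))

theorem descProd_image_anti {s : V → F} {S : Set V} (hS : S.Finite) (hc : IsChain (· ≤ ·) S)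
    {f : V → V} (hf : StrictAnti f) (hs : ∀ v ∈ S, s (f v) = (s v)⁻¹) :
    descProd s (f '' S) = (descProd s S)⁻¹ := by
  obtain ⟨l, hl⟩ := exists_isDescListing hS hc
  have hl' : IsDescListing (l.reverse.map f) (f '' S) :=
    ⟨List.pairwise_map.2 (List.pairwise_reverse.2 (hl.1.imp fun h => hf h)),
      fun v => by simp [hl.2]⟩
  rw [hl.descProd_eq, hl'.descProd_eq, List.prod_inv_reverse, List.map_map, List.map_reverse,
    List.map_map]
  exact congrArg (fun l => List.prod (List.reverse l))
    (List.map_congr_left fun v hv => hs v ((hl.2 v).1 hv))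

end DescProd

/-- A system of half-spaces `{x | pos v x}`, indexed by a set of pairwise nested elements of a
partial order with order-reversing involution, such that only finitely many of them separate
any two points. -/
structure WallSystem (V X : Type*) [PartialOrder V] [InvolutiveNeg V] where
  walls : Set V
  pos : V → X → Prop
  neg_strictAnti : StrictAnti fun v : V => -v
  neg_mem : ∀ v ∈ walls, -v ∈ walls
  pos_mono : ∀ u v x, u ≤ v → pos u x → pos v x
  pos_neg : ∀ v ∈ walls, ∀ x, pos (-v) x ↔ ¬ pos v x
  nested : ∀ u ∈ walls, ∀ v ∈ walls, u ≤ v ∨ v ≤ u ∨ u ≤ -v ∨ -v ≤ u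
  finite_sep : ∀ x y, {v ∈ walls | ¬ pos v x ∧ pos v y}.Finite

namespace WallSystem

variable {V X F : Type*} [PartialOrder V] [InvolutiveNeg V] [Group F] (w : WallSystem V X)

/-- The half-spaces containing `y` but not `x`. -/
def sep (x y : X) : Set V := {v ∈ w.walls | ¬ w.pos v x ∧ w.pos v y}

theorem isChain_sep (x y : X) : IsChain (· ≤ ·) (w.sep x y) := by
  rintro u ⟨hu, hux, huy⟩ v ⟨hv, hvx, hvy⟩ -
  rcases w.nested u hu v hv with h | h | h | h
  · exact Or.inl h
  · exact Or.inr h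
  · exact ((w.pos_neg v hv y).1 (w.pos_mono _ _ _ h huy) hvy).elim
  · exact (hux (w.pos_mono _ _ _ h ((w.pos_neg v hv x).2 hvx))).elim

/-- The ordered product of the labels of the half-spaces entered on the way from `x` to `y`. -/
noncomputable def crossing (s : V → F) (x y : X) : F := descProd s (w.sep x y)

variable {w} {s : V → F}

theorem crossing_eq_one {x y : X} (h : ∀ v ∈ w.walls, w.pos v y → w.pos v x) :
    w.crossing s x y = 1 := by
  rw [crossing, ← descProd_empty s]
  congr
  ext v
  simp only [sep, Set.mem_ofPred_eq, Set.mem_empty_iff_false, iff_false]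
  exact fun h' => h'.2.1 (h v h'.1 h'.2.2)

theorem crossing_mul_crossing (hs : ∀ v ∈ w.walls, s (-v) = (s v)⁻¹) (x y z : X) :
    w.crossing s x y * w.crossing s y z = w.crossing s x z := by
  let A := {v ∈ w.walls | ¬ w.pos v x ∧ w.pos v y ∧ w.pos v z}
  let B := {v ∈ w.walls | ¬ w.pos v x ∧ w.pos v y ∧ ¬ w.pos v z}
  let B' := {v ∈ w.walls | w.pos v x ∧ ¬ w.pos v y ∧ w.pos v z}
  let C := {v ∈ w.walls | ¬ w.pos v x ∧ ¬ w.pos v y ∧ w.pos v z}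
  have hxy : w.sep x y = A ∪ B := by
    ext v
    simp only [sep, A, B, Set.mem_union, Set.mem_ofPred_eq]
    tauto
  have hyz : w.sep y z = B' ∪ C := by
    ext v
    simp only [sep, B', C, Set.mem_union, Set.mem_ofPred_eq]
    tauto
  have hxz : w.sep x z = A ∪ C := by
    ext v
    simp only [sep, A, C, Set.mem_union, Set.mem_ofPred_eq]
    tauto
  have hB : B' = (fun v => -v) '' B := by
    ext v
    constructor
    · rintro ⟨hv, hx, hy, hz⟩
      refine ⟨-v, ⟨w.neg_mem v hv, ?_, ?_, ?_⟩, neg_neg v⟩ <;> rw [w.pos_neg v hv] <;> tauto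
    · rintro ⟨v, ⟨hv, hx, hy, hz⟩, rfl⟩
      refine ⟨w.neg_mem v hv, ?_, ?_, ?_⟩ <;> rw [w.pos_neg v hv] <;> tauto
  have hfin (x y) : (w.sep x y).Finite := w.finite_sep x y
  have e1 : w.crossing s x y = descProd s A * descProd s B := by
    rw [crossing, hxy]
    exact descProd_union (hxy ▸ hfin x y) (hxy ▸ w.isChain_sep x y)
      fun a ha b hb hab => hb.2.2.2 (w.pos_mono _ _ _ hab ha.2.2.2)
  have e2 : w.crossing s y z = descProd s B' * descProd s C := by
    rw [crossing, hyz]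
    exact descProd_union (hyz ▸ hfin y z) (hyz ▸ w.isChain_sep y z)
      fun a ha b hb hab => hb.2.1 (w.pos_mono _ _ _ hab ha.2.1)
  have e3 : w.crossing s x z = descProd s A * descProd s C := by
    rw [crossing, hxz]
    exact descProd_union (hxz ▸ hfin x z) (hxz ▸ w.isChain_sep x z)
      fun a ha b hb hab => hb.2.2.1 (w.pos_mono _ _ _ hab ha.2.2.1)
  have e4 : descProd s B' = (descProd s B)⁻¹ := by
    have hsub : B ⊆ w.sep x y := hxy ▸ Set.subset_union_right
    rw [hB]
    exact descProd_image_anti ((hfin x y).subset hsub) ((w.isChain_sep x y).mono hsub)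
      w.neg_strictAnti fun v hv => hs v hv.1
  rw [e1, e2, e3, e4]
  group

theorem crossing_symm (hs : ∀ v ∈ w.walls, s (-v) = (s v)⁻¹) (x y : X) :
    w.crossing s y x = (w.crossing s x y)⁻¹ := by
  rw [eq_inv_iff_mul_eq_one, crossing_mul_crossing hs, crossing_eq_one fun _ _ h => h]

theorem crossing_map {f : V ≃o V} {g : X → X} (hf : ∀ v, f v ∈ w.walls ↔ v ∈ w.walls)
    (hpos : ∀ v x, w.pos (f v) (g x) ↔ w.pos v x) (hs : ∀ v ∈ w.walls, s (f v) = s v) (x y : X) :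
    w.crossing s (g x) (g y) = w.crossing s x y := by
  rw [crossing, crossing, ← descProd_image (s := s) (S := w.sep x y) (w.finite_sep x y)
    (w.isChain_sep x y) f.strictMono fun v hv => hs v hv.1]
  congr
  ext v
  constructor
  · intro hv
    refine ⟨f.symm v, ?_, f.apply_symm_apply v⟩
    obtain ⟨v, rfl⟩ := f.surjective v
    simp only [sep, Set.mem_ofPred_eq, hf, hpos, OrderIso.symm_apply_apply] at hv ⊢
    exact hv
  · rintro ⟨v, hv, rfl⟩
    simp only [sep, Set.mem_ofPred_eq, hf, hpos] at hv ⊢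
    exact hv

end WallSystem

/-- The properties of the ring of integers of an imaginary quadratic field that are used below:
a conjugation with integral norm and trace, with finite sets of bounded norm and finite quotients,
together with an integer `D ≥ 3` which is not a quotient of two norms. -/
structure ImaginaryConj (R : Type*) [CommRing R] where
  conj : R →+* R
  nm : R → ℤ
  tr : R → ℤ
  D : ℤ
  conj_conj : ∀ x, conj (conj x) = x
  nm_cast : ∀ x, (nm x : R) = x * conj x
  tr_cast : ∀ x, (tr x : R) = x + conj x
  nm_nonneg : ∀ x, 0 ≤ nm x
  eq_zero_of_nm : ∀ x, nm x = 0 → x = 0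
  finite_nm_le : ∀ B, {x | nm x ≤ B}.Finite
  finite_quotient : ∀ n : ℤ, n ≠ 0 → Finite (R ⧸ Ideal.span {(n : R)})
  three_le_D : 3 ≤ D
  eq_zero_of_nm_eq : ∀ x y, nm x = D * nm y → y = 0

/-- Binary Hermitian forms with diagonal coefficients `a`, `c` and off-diagonal coefficient `b`. -/
@[ext]
structure HermForm {R : Type*} [CommRing R] (Q : ImaginaryConj R) where
  a : ℤ
  b : R
  c : ℤ

namespace HermForm

open Matrix MatrixGroups

variable {R : Type*} [CommRing R] {Q : ImaginaryConj R}

attribute [simp] ImaginaryConj.conj_conj ImaginaryConj.nm_cast ImaginaryConj.tr_cast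

instance : InvolutiveNeg (HermForm Q) where
  neg v := ⟨-v.a, -v.b, -v.c⟩
  neg_neg v := by ext <;> exact neg_neg _

instance : Sub (HermForm Q) := ⟨fun v w => ⟨v.a - w.a, v.b - w.b, v.c - w.c⟩⟩

@[simp] theorem neg_a (v : HermForm Q) : (-v).a = -v.a := rfl
@[simp] theorem neg_b (v : HermForm Q) : (-v).b = -v.b := rfl
@[simp] theorem neg_c (v : HermForm Q) : (-v).c = -v.c := rfl
@[simp] theorem sub_a (v w : HermForm Q) : (v - w).a = v.a - w.a := rfl
@[simp] theorem sub_b (v w : HermForm Q) : (v - w).b = v.b - w.b := rfl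
@[simp] theorem sub_c (v w : HermForm Q) : (v - w).c = v.c - w.c := rfl

/-- The value of a Hermitian form at a vector. -/
def ev (v : HermForm Q) (p q : R) : ℤ :=
  v.a * Q.nm p + Q.tr (v.b * p * Q.conj q) + v.c * Q.nm q

theorem ev_cast (v : HermForm Q) (p q : R) :
    (v.ev p q : R) = v.a * (p * Q.conj p) + (v.b * p * Q.conj q + Q.conj v.b * Q.conj p * q) +
      v.c * (q * Q.conj q) := by
  simp [ev]

/-- The determinant of a Hermitian form. -/
def det (v : HermForm Q) : ℤ := v.a * v.c - Q.nm v.b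

theorem det_cast (v : HermForm Q) : (v.det : R) = v.a * v.c - v.b * Q.conj v.b := by
  simp [det]

/-- The pullback of a Hermitian form under a matrix. -/
def act (v : HermForm Q) (g : SL(2, R)) : HermForm Q where
  a := v.ev (g 0 0) (g 1 0)
  b := v.a * g 0 0 * Q.conj (g 0 1) + v.b * g 0 0 * Q.conj (g 1 1) +
    Q.conj v.b * g 1 0 * Q.conj (g 0 1) + v.c * g 1 0 * Q.conj (g 1 1)
  c := v.ev (g 0 1) (g 1 1)

/-- Congruence of Hermitian forms modulo an integer. -/
def Congr (n : ℤ) (v w : HermForm Q) : Prop :=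
  (n : R) ∣ v.a - w.a ∧ (n : R) ∣ v.b - w.b ∧ (n : R) ∣ v.c - w.c

theorem Congr.symm {n : ℤ} {v w : HermForm Q} (h : Congr n v w) : Congr n w v := by
  obtain ⟨h1, h2, h3⟩ := h
  exact ⟨dvd_sub_comm.1 h1, dvd_sub_comm.1 h2, dvd_sub_comm.1 h3⟩

theorem Congr.trans {n : ℤ} {u v w : HermForm Q} (h : Congr n u v) (h' : Congr n v w) :
    Congr n u w := by
  obtain ⟨h1, h2, h3⟩ := h
  obtain ⟨h1', h2', h3'⟩ := h'
  refine ⟨?_, ?_, ?_⟩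
  · simpa using dvd_add h1 h1'
  · simpa using dvd_add h2 h2'
  · simpa using dvd_add h3 h3'

/-- The matrices congruent to the identity modulo `n`. -/
def Gam (R : Type*) [CommRing R] (n : ℤ) : Subgroup SL(2, R) :=
  (SpecialLinearGroup.map (n := Fin 2) (Ideal.Quotient.mk (Ideal.span {(n : R)}))).ker

instance (n : ℤ) : (Gam R n).Normal := by unfold Gam; infer_instance

theorem dvd_sub_iff {n : ℤ} {x y : R} : (n : R) ∣ x - y ↔
    Ideal.Quotient.mk (Ideal.span {(n : R)}) x = Ideal.Quotient.mk (Ideal.span {(n : R)}) y := by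
  rw [Ideal.Quotient.mk_eq_mk_iff_sub_mem, Ideal.mem_span_singleton]

theorem mem_gam_iff {n : ℤ} {g : SL(2, R)} : g ∈ Gam R n ↔
    (n : R) ∣ g 0 0 - 1 ∧ (n : R) ∣ g 0 1 ∧ (n : R) ∣ g 1 0 ∧ (n : R) ∣ g 1 1 - 1 := by
  rw [← sub_zero (g 0 1), ← sub_zero (g 1 0)]
  simp only [dvd_sub_iff, Gam, MonoidHom.mem_ker, map_one, map_zero]
  constructor
  · intro h
    have hent (i j) := congrFun (congrFun (congrArg Subtype.val h) i) j
    exact ⟨hent 0 0, hent 0 1, hent 1 0, hent 1 1⟩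
  · rintro ⟨h1, h2, h3, h4⟩
    ext i j
    fin_cases i <;> fin_cases j <;> simpa

theorem congr_act {n : ℤ} {g : SL(2, R)} (hg : g ∈ Gam R n) (v : HermForm Q) :
    Congr n (v.act g) v := by
  obtain ⟨h1, h2, h3, h4⟩ := mem_gam_iff.1 hg
  have hσ {x : R} (h : (n : R) ∣ x) : (n : R) ∣ Q.conj x := by
    simpa using map_dvd Q.conj h
  have h1' := hσ h1
  have h2' := hσ h2
  have h3' := hσ h3
  have h4' := hσ h4
  simp only [map_sub, map_one] at h1' h4'
  rw [← sub_zero (g 0 1)] at h2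
  rw [← sub_zero (g 1 0)] at h3
  rw [← sub_zero (Q.conj (g 0 1))] at h2'
  rw [← sub_zero (Q.conj (g 1 0))] at h3'
  rw [dvd_sub_iff] at h1 h2 h3 h4 h1' h2' h3' h4'
  simp only [Congr, dvd_sub_iff, act, ev_cast, map_add, map_mul, h1, h2, h3, h4, h1', h2', h3', h4']
  simp

theorem gam_le {m n : ℤ} (h : m ∣ n) : Gam R n ≤ Gam R m := by
  intro g hg
  have h' : (m : R) ∣ (n : R) := by simpa using map_dvd (Int.castRingHom R) h
  obtain ⟨h1, h2, h3, h4⟩ := mem_gam_iff.1 hg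
  exact mem_gam_iff.2 ⟨h'.trans h1, h'.trans h2, h'.trans h3, h'.trans h4⟩

variable (Q) in
/-- The level of the congruence conditions. -/
def lev : ℤ := 2 * Q.D + 1

variable (Q) in
/-- The form with coefficients `-1`, `0`, `D`. -/
def base : HermForm Q := ⟨-1, 0, Q.D⟩

theorem lev_dvd_sq : lev Q ∣ lev Q ^ 2 := dvd_pow_self _ two_ne_zero

theorem not_lev_dvd {m : ℤ} (h1 : m ≠ 0) (h2 : |m| < lev Q) : ¬ lev Q ∣ m :=
  fun h => h1 (Int.eq_zero_of_abs_lt_dvd h h2)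

open Classical in
/-- The generator of the free group attached to a congruence class of Hermitian forms. -/
noncomputable def preLabel (v : HermForm Q) : FreeGroup Bool :=
  if Congr (lev Q ^ 2) v ⟨-1, (lev Q : R), Q.D⟩ then FreeGroup.of true
  else if Congr (lev Q ^ 2) v ⟨-1, (lev Q * 2 : R), Q.D⟩ then FreeGroup.of false
  else 1

/-- The label of a wall, inverted when the sides of the wall are exchanged. -/
noncomputable def label (v : HermForm Q) : FreeGroup Bool := preLabel v * (preLabel (-v))⁻¹

theorem label_neg (v : HermForm Q) : label (-v) = (label v)⁻¹ := by
  simp [label]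

theorem Congr.neg {n : ℤ} {v w : HermForm Q} (h : Congr n v w) : Congr n (-v) (-w) := by
  obtain ⟨⟨x, hx⟩, ⟨y, hy⟩, ⟨z, hz⟩⟩ := h
  refine ⟨⟨-x, ?_⟩, ⟨-y, ?_⟩, ⟨-z, ?_⟩⟩
  · push_cast [neg_a]; linear_combination -hx
  · push_cast [neg_b]; linear_combination -hy
  · push_cast [neg_c]; linear_combination -hz

theorem label_congr {v w : HermForm Q} (h : Congr (lev Q ^ 2) v w) : label v = label w := by
  have key {v w : HermForm Q} (h : Congr (lev Q ^ 2) v w) : preLabel v = preLabel w := by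
    have (u : HermForm Q) : Congr (lev Q ^ 2) v u ↔ Congr (lev Q ^ 2) w u :=
      ⟨h.symm.trans, h.trans⟩
    unfold preLabel
    split_ifs <;> simp_all
  rw [label, label, key h, key h.neg]

theorem preLabel_eq_one {v : HermForm Q} (h : ∀ k : ℤ, k = 1 ∨ k = 2 →
    ¬ Congr (lev Q ^ 2) v ⟨-1, (lev Q * k : R), Q.D⟩) : preLabel v = 1 := by
  have h1 := h 1 (Or.inl rfl)
  have h2 := h 2 (Or.inr rfl)
  simp only [Int.cast_one, mul_one, Int.cast_ofNat] at h1 h2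
  rw [preLabel, if_neg h1, if_neg h2]

/-- The matrix of the rotation exchanging the coordinate axes. -/
def rot : SL(2, R) := ⟨!![0, -1; 1, 0], by simp⟩

/-- The upper unipotent matrix with off-diagonal entry `x`. -/
def upper (x : R) : SL(2, R) := ⟨!![1, x; 0, 1], by simp⟩

/-- The lower unipotent matrix with off-diagonal entry `x`. -/
def lower (x : R) : SL(2, R) := ⟨!![1, 0; x, 1], by simp⟩

@[simp] theorem upper_zero_zero (x : R) : upper x 0 0 = 1 := rfl
@[simp] theorem upper_zero_one (x : R) : upper x 0 1 = x := rfl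
@[simp] theorem upper_one_zero (x : R) : upper x 1 0 = 0 := rfl
@[simp] theorem upper_one_one (x : R) : upper x 1 1 = 1 := rfl
@[simp] theorem lower_zero_zero (x : R) : lower x 0 0 = 1 := rfl
@[simp] theorem lower_zero_one (x : R) : lower x 0 1 = 0 := rfl
@[simp] theorem lower_one_zero (x : R) : lower x 1 0 = x := rfl
@[simp] theorem lower_one_one (x : R) : lower x 1 1 = 1 := rfl

theorem mul_entry (g h : SL(2, R)) (i j : Fin 2) : (g * h) i j = g i 0 * h 0 j + g i 1 * h 1 j := by
  rw [Matrix.SpecialLinearGroup.coe_mul, Matrix.mul_apply, Fin.sum_univ_two]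

theorem upper_inv (x : R) : (upper x)⁻¹ = upper (-x) := by
  ext i j
  fin_cases i <;> fin_cases j <;> simp [Matrix.SpecialLinearGroup.coe_inv, Matrix.adjugate_fin_two]

theorem upper_mem {x : R} {n : ℤ} (h : (n : R) ∣ x) : upper x ∈ Gam R n :=
  mem_gam_iff.2 (by simpa using h)

theorem lower_mem {x : R} {n : ℤ} (h : (n : R) ∣ x) : lower x ∈ Gam R n :=
  mem_gam_iff.2 (by simpa using h)

theorem act_inv_b (g : SL(2, R)) : ((base Q).act g⁻¹).b =
    g 1 1 * Q.conj (g 0 1) - Q.D * g 1 0 * Q.conj (g 0 0) := by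
  simp [act, base, Matrix.SpecialLinearGroup.coe_inv, Matrix.adjugate_fin_two]
  ring

theorem gam_finiteIndex (Q : ImaginaryConj R) {n : ℤ} (hn : n ≠ 0) : (Gam R n).FiniteIndex := by
  have := Q.finite_quotient n hn
  have : Finite (Matrix.SpecialLinearGroup (Fin 2) (R ⧸ Ideal.span {(n : R)})) := Subtype.finite
  exact Subgroup.finiteIndex_ker _

/-- The companion matrix of the polynomial `X ^ 2 - t * X + 1`. -/
def companion (t : R) : SL(2, R) := ⟨!![t, -1; 1, 0], by simp⟩

theorem companion_add (x t : R) : companion (x + t) = upper x * companion t := by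
  ext i j
  rw [mul_entry]
  fin_cases i <;> fin_cases j <;> simp [companion, add_comm]

theorem traceSetPM_eq_univ {H : Subgroup SL(2, R)}
    (h : ∀ t ∈ Set.range companion, ∃ g, g * t * g⁻¹ ∈ H) : traceSetPM H = Set.univ := by
  refine Set.eq_univ_of_forall fun t => ?_
  obtain ⟨g, hg⟩ := h _ ⟨t, rfl⟩
  refine ⟨_, hg, Or.inl ?_⟩
  rw [Matrix.SpecialLinearGroup.coe_mul, Matrix.SpecialLinearGroup.coe_mul, Matrix.trace_mul_comm,
    ← mul_assoc, ← Matrix.SpecialLinearGroup.coe_mul, inv_mul_cancel]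
  simp [companion, Matrix.trace_fin_two]

variable [CharZero R]

theorem ev_neg (v : HermForm Q) (p q : R) : (-v).ev p q = -v.ev p q := by
  apply Int.cast_injective (α := R)
  push_cast [ev_cast]
  simp
  ring

theorem ev_sub (v w : HermForm Q) (p q : R) : (v - w).ev p q = v.ev p q - w.ev p q := by
  apply Int.cast_injective (α := R)
  push_cast [ev_cast]
  simp
  ring

theorem a_mul_ev (v : HermForm Q) (p q : R) :
    v.a * v.ev p q = Q.nm (v.a * p + Q.conj v.b * q) + v.det * Q.nm q := by
  apply Int.cast_injective (α := R)
  push_cast [ev_cast, det_cast]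
  simp
  ring

theorem det_neg (v : HermForm Q) : (-v).det = v.det := by
  apply Int.cast_injective (α := R)
  simp [det_cast]

theorem det_sub_add (v w : HermForm Q) :
    (w - v).det + (-w - v).det = 2 * v.det + 2 * w.det := by
  apply Int.cast_injective (α := R)
  push_cast [det_cast]
  simp
  ring

theorem nm_zero : Q.nm 0 = 0 := by
  apply Int.cast_injective (α := R)
  simp

theorem nm_one : Q.nm 1 = 1 := by
  apply Int.cast_injective (α := R)
  simp

theorem tr_zero : Q.tr 0 = 0 := by
  apply Int.cast_injective (α := R)
  simp

@[simp] theorem ev_one_zero (v : HermForm Q) : v.ev 1 0 = v.a := by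
  simp [ev, nm_zero, nm_one, tr_zero]

@[simp] theorem ev_zero_one (v : HermForm Q) : v.ev 0 1 = v.c := by
  simp [ev, nm_zero, nm_one, tr_zero]

theorem ext_ev {v w : HermForm Q} (h : ∀ p q, v.ev p q = w.ev p q) : v = w := by
  have ha : v.a = w.a := by simpa using h 1 0
  have hc : v.c = w.c := by simpa using h 0 1
  have hb := h (Q.conj (v.b - w.b)) 1
  have h2 : (v - w).ev (Q.conj (v.b - w.b)) 1 = 2 * Q.nm (v.b - w.b) := by
    apply Int.cast_injective (α := R)
    push_cast [ev_cast]
    simp [ha, hc]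
    ring
  rw [ev_sub, hb, sub_self] at h2
  exact HermForm.ext ha (sub_eq_zero.1 (Q.eq_zero_of_nm _ (by omega))) hc

instance : PartialOrder (HermForm Q) where
  le v w := ∀ p q, v.ev p q ≤ w.ev p q
  le_refl v p q := le_rfl
  le_trans u v w h h' p q := (h p q).trans (h' p q)
  le_antisymm _ _ h h' := ext_ev fun p q => (h p q).antisymm (h' p q)

theorem neg_le_neg {v w : HermForm Q} (h : v ≤ w) : -w ≤ -v := fun p q => by
  rw [ev_neg, ev_neg]
  exact _root_.neg_le_neg (h p q)

theorem neg_strictAnti : StrictAnti fun v : HermForm Q => -v := fun _ _ h =>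
  (neg_le_neg h.le).lt_of_ne fun h' => h.ne (neg_injective h').symm

theorem ev_nonneg_or_nonpos {v : HermForm Q} (h : 0 ≤ v.det) :
    (∀ p q, 0 ≤ v.ev p q) ∨ ∀ p q, v.ev p q ≤ 0 := by
  have key (p q) : 0 ≤ v.a * v.ev p q := by
    rw [a_mul_ev]
    have := Q.nm_nonneg (v.a * p + Q.conj v.b * q)
    have := mul_nonneg h (Q.nm_nonneg q)
    omega
  rcases lt_trichotomy v.a 0 with ha | ha | ha
  · exact Or.inr fun p q => nonpos_of_mul_nonneg_right (key p q) ha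
  · have hb : v.b = 0 := by
      refine Q.eq_zero_of_nm _ ((Q.nm_nonneg _).antisymm' ?_)
      simpa [det, ha] using h
    have hev (p q) : v.ev p q = v.c * Q.nm q := by simp [ev, ha, hb, tr_zero]
    simp only [hev]
    rcases le_total 0 v.c with hc | hc
    · exact Or.inl fun p q => mul_nonneg hc (Q.nm_nonneg q)
    · exact Or.inr fun p q => mul_nonpos_of_nonpos_of_nonneg hc (Q.nm_nonneg q)
  · exact Or.inl fun p q => nonneg_of_mul_nonneg_right (key p q) ha

theorem le_or_le_of_det_nonneg {v w : HermForm Q} (h : 0 ≤ (w - v).det) : v ≤ w ∨ w ≤ v := by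
  refine (ev_nonneg_or_nonpos h).imp (fun h p q => ?_) (fun h p q => ?_) <;>
  · have := h p q
    rw [ev_sub] at this
    omega

theorem ev_act (v : HermForm Q) (g : SL(2, R)) (p q : R) :
    (v.act g).ev p q = v.ev (g 0 0 * p + g 0 1 * q) (g 1 0 * p + g 1 1 * q) := by
  apply Int.cast_injective (α := R)
  push_cast [ev_cast, act]
  simp
  ring

theorem act_act (v : HermForm Q) (g h : SL(2, R)) : (v.act g).act h = v.act (g * h) := by
  refine ext_ev fun p q => ?_
  simp only [ev_act, Matrix.SpecialLinearGroup.coe_mul, Matrix.mul_apply, Fin.sum_univ_two]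
  congr 1 <;> ring

theorem act_one (v : HermForm Q) : v.act 1 = v := by
  refine ext_ev fun p q => ?_
  simp [ev_act]

theorem act_neg (v : HermForm Q) (g : SL(2, R)) : (-v).act g = -v.act g := by
  refine ext_ev fun p q => ?_
  simp only [ev_act, ev_neg]

theorem det_act (v : HermForm Q) (g : SL(2, R)) : (v.act g).det = v.det := by
  apply Int.cast_injective (α := R)
  have h1 : g 0 0 * g 1 1 - g 0 1 * g 1 0 = 1 := by
    rw [← Matrix.det_fin_two]; exact g.det_coe
  have h2 := congrArg Q.conj h1
  simp only [map_sub, map_mul, map_one] at h2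
  have : (v.det : R) = v.det * (g 0 0 * g 1 1 - g 0 1 * g 1 0) *
      (Q.conj (g 0 0) * Q.conj (g 1 1) - Q.conj (g 0 1) * Q.conj (g 1 0)) := by
    rw [h1, h2, mul_one, mul_one]
  rw [this, det_cast, det_cast]
  simp only [act, ev_cast]
  simp
  ring

/-- Pullback by a matrix as an automorphism of the ordered set of Hermitian forms. -/
def actIso (g : SL(2, R)) : HermForm Q ≃o HermForm Q where
  toFun v := v.act g
  invFun v := v.act g⁻¹
  left_inv v := by simp [act_act, act_one]
  right_inv v := by simp [act_act, act_one]
  map_rel_iff' {v w} := by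
    refine ⟨fun h => ?_, fun h p q => ?_⟩
    · have (u : HermForm Q) : u = (u.act g).act g⁻¹ := by simp [act_act, act_one]
      rw [this v, this w]
      intro p q
      rw [ev_act, ev_act (w.act g)]
      exact h _ _
    · exact (ev_act v g p q).trans_le ((h _ _).trans_eq (ev_act w g p q).symm)

theorem int_dvd_of_cast_dvd (Q : ImaginaryConj R) {n k : ℤ} (h : (n : R) ∣ (k : R)) : n ∣ k := by
  obtain ⟨x, hx⟩ := h
  have : k ^ 2 = n ^ 2 * Q.nm x := by
    apply Int.cast_injective (α := R)
    have h2 := congrArg Q.conj hx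
    simp only [map_intCast, map_mul] at h2
    push_cast
    rw [sq, Q.nm_cast]
    nth_rewrite 1 [hx]
    rw [h2]
    ring
  exact (Int.pow_dvd_pow_iff two_ne_zero).1 ⟨_, this⟩

/-- Forms of determinant `-D` congruent to the base form modulo the level, and their negatives. -/
def IsWall (v : HermForm Q) : Prop :=
  v.det = -Q.D ∧ (Congr (lev Q) v (base Q) ∨ Congr (lev Q) (-v) (base Q))

theorem IsWall.neg {v : HermForm Q} (hv : IsWall v) : IsWall (-v) :=
  ⟨by rw [det_neg, hv.1], by rw [neg_neg]; exact hv.2.symm⟩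

theorem isWall_base : IsWall (base Q) :=
  ⟨by simp [det, base, nm_zero], Or.inl ⟨by simp, by simp, by simp⟩⟩

theorem IsWall.act {v : HermForm Q} (hv : IsWall v) {g : SL(2, R)} (hg : g ∈ Gam R (lev Q)) :
    IsWall (v.act g) := by
  refine ⟨by rw [det_act, hv.1], hv.2.imp (congr_act hg v).trans fun h => ?_⟩
  rw [← act_neg]
  exact (congr_act hg _).trans h

theorem isWall_act_iff {v : HermForm Q} {g : SL(2, R)} (hg : g ∈ Gam R (lev Q)) :
    IsWall (v.act g) ↔ IsWall v := by
  refine ⟨fun h => ?_, fun h => h.act hg⟩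
  simpa [act_act, act_one] using h.act (inv_mem hg)

theorem comparable_of_congr {v w : HermForm Q} (hv : v.det = -Q.D) (hw : w.det = -Q.D)
    (h : Congr (lev Q) v (base Q)) (h' : Congr (lev Q) w (base Q)) :
    v ≤ w ∨ w ≤ v ∨ v ≤ -w ∨ -w ≤ v := by
  obtain ⟨⟨x, hx⟩, ⟨y, hy⟩, ⟨z, hz⟩⟩ := h'.trans h.symm
  have hdvd : lev Q ^ 2 ∣ (w - v).det := by
    refine int_dvd_of_cast_dvd Q ⟨x * z - y * Q.conj y, ?_⟩
    rw [det_cast]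
    push_cast [sub_a, sub_b, sub_c]
    rw [hx, hy, hz, map_mul, map_intCast]
    ring
  obtain ⟨e, he⟩ := hdvd
  have hD := Q.three_le_D
  rcases le_or_gt 0 e with h0 | h0
  · rcases le_or_le_of_det_nonneg (v := v) (w := w) (by rw [he]; positivity) with h | h
    · exact Or.inl h
    · exact Or.inr (Or.inl h)
  · have h1 : 0 ≤ (-w - v).det := by
      have := det_sub_add v w
      have hl : lev Q = 2 * Q.D + 1 := rfl
      nlinarith
    exact Or.inr (Or.inr (le_or_le_of_det_nonneg h1))

theorem IsWall.comparable {v w : HermForm Q} (hv : IsWall v) (hw : IsWall w) :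
    v ≤ w ∨ w ≤ v ∨ v ≤ -w ∨ -w ≤ v := by
  have hneg {u u' : HermForm Q} (h : -u ≤ u') : -u' ≤ u := by simpa using neg_le_neg h
  have hneg' {u u' : HermForm Q} (h : u ≤ -u') : u' ≤ -u := by simpa using neg_le_neg h
  have hneg'' {u u' : HermForm Q} (h : -u ≤ -u') : u' ≤ u := by simpa using neg_le_neg h
  rcases hv.2 with h | h <;> rcases hw.2 with h' | h'
  · exact comparable_of_congr hv.1 hw.1 h h'
  · have := comparable_of_congr hv.1 hw.neg.1 h h'
    rw [neg_neg] at this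
    tauto
  · rcases comparable_of_congr hv.neg.1 hw.1 h h' with h | h | h | h
    · exact Or.inr (Or.inr (Or.inr (hneg h)))
    · exact Or.inr (Or.inr (Or.inl (hneg' h)))
    · exact Or.inr (Or.inl (hneg'' h))
    · exact Or.inl (hneg'' h)
  · have := comparable_of_congr hv.neg.1 hw.neg.1 h h'
    rw [neg_neg] at this
    rcases this with h | h | h | h
    · exact Or.inr (Or.inl (hneg'' h))
    · exact Or.inl (hneg'' h)
    · exact Or.inr (Or.inr (Or.inr (hneg h)))
    · exact Or.inr (Or.inr (Or.inl (hneg' h)))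

theorem ev_ne_zero {v : HermForm Q} (hv : v.det = -Q.D) {p q : R} (hpq : ¬ (p = 0 ∧ q = 0)) :
    v.ev p q ≠ 0 := by
  intro h
  have ha (h0 : v.a = 0) : False := by
    have h1 := Q.eq_zero_of_nm_eq v.b 1 (by rw [nm_one]; simp [det, h0] at hv; omega)
    have := nm_one (Q := Q)
    rw [h1, nm_zero] at this
    omega
  have h2 := a_mul_ev v p q
  rw [h, hv, mul_zero] at h2
  have hq : q = 0 := Q.eq_zero_of_nm_eq (v.a * p + Q.conj v.b * q) q (by linarith)
  subst hq
  have h3 : v.a * Q.nm p = 0 := by simpa [ev, nm_zero, tr_zero] using h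
  exact hpq ⟨Q.eq_zero_of_nm p ((mul_eq_zero.1 h3).resolve_left ha), rfl⟩

theorem col_ne_zero (g : SL(2, R)) : ¬ (g 0 0 = 0 ∧ g 1 0 = 0) := by
  rintro ⟨h1, h2⟩
  have : g 0 0 * g 1 1 - g 0 1 * g 1 0 = 1 := by
    rw [← Matrix.det_fin_two]; exact g.det_coe
  simp [h1, h2] at this

/-- Positivity of a Hermitian form at the first column of a matrix. -/
def PosAt (v : HermForm Q) (g : SL(2, R)) : Prop := 0 < v.ev (g 0 0) (g 1 0)

theorem posAt_neg {v : HermForm Q} (hv : IsWall v) (g : SL(2, R)) : PosAt (-v) g ↔ ¬ PosAt v g := by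
  have := ev_ne_zero hv.1 (col_ne_zero g)
  rw [PosAt, PosAt, ev_neg]
  omega

theorem posAt_act (v : HermForm Q) (g h : SL(2, R)) : PosAt (v.act g) h ↔ PosAt v (g * h) := by
  simp only [PosAt, ev_act, Matrix.SpecialLinearGroup.coe_mul, Matrix.mul_apply, Fin.sum_univ_two]

theorem finite_sep_one [IsDomain R] (h : SL(2, R)) :
    {v : HermForm Q | IsWall v ∧ ¬ PosAt v 1 ∧ PosAt v h}.Finite := by
  set p := h 0 0 with hp
  set q := h 1 0 with hq
  have key (v : HermForm Q) (hv : IsWall v) (h1 : ¬ PosAt v 1) (h2 : PosAt v h) :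
      v.a < 0 ∧ 0 < v.ev p q := by
    have h3 := ev_ne_zero hv.1 (p := 1) (q := 0) (by simp)
    simp only [PosAt, Matrix.SpecialLinearGroup.coe_one, Matrix.one_apply_eq, ne_eq, one_ne_zero,
      not_false_eq_true, Matrix.one_apply_ne, ev_one_zero] at h1 h3
    exact ⟨by omega, h2⟩
  by_cases hq0 : q = 0
  · convert Set.finite_empty
    ext v
    simp only [Set.mem_ofPred_eq, Set.mem_empty_iff_false, iff_false]
    rintro ⟨hv, h1, h2⟩
    obtain ⟨h3, h4⟩ := key v hv h1 h2
    have h5 : v.ev p q = v.a * Q.nm p := by simp [ev, hq0, nm_zero, tr_zero]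
    have := mul_nonpos_of_nonpos_of_nonneg h3.le (Q.nm_nonneg p)
    omega
  · refine Set.Finite.of_finite_image (f := fun v => (v.a, (v.a * p + Q.conj v.b * q : R)))
      (((Set.finite_Icc (-(Q.D * Q.nm q)) 0).prod (Q.finite_nm_le (Q.D * Q.nm q))).subset ?_) ?_
    · rintro _ ⟨v, ⟨hv, h1, h2⟩, rfl⟩
      obtain ⟨h3, h4⟩ := key v hv h1 h2
      have h5 := a_mul_ev v p q
      have h6 := Q.nm_nonneg (v.a * p + Q.conj v.b * q)
      rw [hv.1] at h5
      refine ⟨⟨?_, h3.le⟩, ?_⟩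
      · change -(Q.D * Q.nm q) ≤ v.a
        nlinarith
      · change Q.nm (v.a * p + Q.conj v.b * q) ≤ Q.D * Q.nm q
        nlinarith
    · rintro v ⟨hv, h1, h2⟩ w ⟨hw, -, -⟩ hvw
      simp only [Prod.mk.injEq] at hvw
      obtain ⟨ha, hb⟩ := hvw
      rw [ha, add_right_inj] at hb
      have hb' : v.b = w.b := by
        rw [← Q.conj_conj v.b, mul_right_cancel₀ hq0 hb, Q.conj_conj]
      have hc : v.a * v.c = v.a * w.c := by
        have h3 := hv.1
        have h4 := hw.1
        simp only [det] at h3 h4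
        rw [hb'] at h3
        rw [← ha] at h4
        omega
      exact HermForm.ext ha hb' (mul_left_cancel₀ (key v hv h1 h2).1.ne hc)

variable (Q) in
/-- The system of half-spaces defined by the Hermitian forms satisfying `IsWall`. -/
def wallSystem [IsDomain R] : WallSystem (HermForm Q) SL(2, R) where
  walls := {v | IsWall v}
  pos := PosAt
  neg_strictAnti := neg_strictAnti
  neg_mem _ hv := hv.neg
  pos_mono u v x h hu := lt_of_lt_of_le hu (h _ _)
  pos_neg _ hv x := posAt_neg hv x
  nested _ hu _ hv := hu.comparable hv
  finite_sep x y := by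
    refine (((finite_sep_one x).image fun v => -v).union (finite_sep_one y)).subset ?_
    rintro v ⟨hv, hx, hy⟩
    by_cases h : PosAt v 1
    · refine Or.inl ⟨-v, ⟨hv.neg, ?_, ?_⟩, neg_neg v⟩ <;> rw [posAt_neg hv] <;> tauto
    · exact Or.inr ⟨hv, h, hy⟩

theorem Congr.dvd_a {n : ℤ} {v w : HermForm Q} (h : Congr n v w) : n ∣ v.a - w.a :=
  int_dvd_of_cast_dvd Q (by simpa using h.1)

theorem label_eq_preLabel {v : HermForm Q} (hv : Congr (lev Q) v (base Q)) :
    label v = preLabel v := by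
  rw [label, preLabel_eq_one (v := -v), inv_one, mul_one]
  intro k _ h
  have h1 := hv.dvd_a
  have h2 := lev_dvd_sq.trans h.dvd_a
  simp only [base, neg_a] at h1 h2
  have h3 := Int.le_of_dvd (by norm_num) ((dvd_add h1 h2).trans (by ring_nf; rfl) : lev Q ∣ 2)
  have := Q.three_le_D
  rw [lev] at h3
  omega

theorem label_eq_one {v : HermForm Q} (hv : Congr (lev Q) v (base Q)) {m : ℤ}
    (hm : ((lev Q ^ 2 : ℤ) : R) ∣ v.b - lev Q * m) (h1 : ¬ lev Q ∣ m - 1) (h2 : ¬ lev Q ∣ m - 2) :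
    label v = 1 := by
  rw [label_eq_preLabel hv, preLabel_eq_one]
  rintro k hk ⟨-, h, -⟩
  have h3 : lev Q ^ 2 ∣ lev Q * (m - k) := by
    refine int_dvd_of_cast_dvd Q ?_
    have := dvd_sub h hm
    push_cast at this ⊢
    convert this using 1
    ring
  have h0 : lev Q ≠ 0 := by
    have := Q.three_le_D
    rw [lev]
    omega
  rw [sq] at h3
  have h4 := Int.dvd_of_mul_dvd_mul_left h0 h3
  rcases hk with rfl | rfl
  · exact h1 h4
  · exact h2 h4

theorem label_act_inv {g : SL(2, R)} (hg : g ∈ Gam R (lev Q)) {m : ℤ}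
    (h : ((lev Q ^ 2 : ℤ) : R) ∣ g 1 1 * Q.conj (g 0 1) - Q.D * g 1 0 * Q.conj (g 0 0) - lev Q * m)
    (h1 : ¬ lev Q ∣ m - 1) (h2 : ¬ lev Q ∣ m - 2) : label ((base Q).act g⁻¹) = 1 :=
  label_eq_one (congr_act (inv_mem hg) _) (by rwa [act_inv_b]) h1 h2

theorem eq_base {v : HermForm Q} (hv : IsWall v) (ha : v.a ≤ 0) (hc : 0 < v.c) : v = base Q := by
  have hD := Q.three_le_D
  have hdet := hv.1
  have hb := Q.nm_nonneg v.b
  simp only [det] at hdet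
  have ha0 : v.a ≠ 0 := by
    have := ev_ne_zero hv.1 (p := 1) (q := 0) (by simp)
    simpa using this
  have ha1 : v.a ≤ -1 := by omega
  have ha2 : -Q.D ≤ v.a := by nlinarith
  have hc1 : v.c ≤ Q.D := by nlinarith
  have hcong : Congr (lev Q) v (base Q) := hv.2.resolve_right fun h => by
    have := Int.le_of_dvd (by simp only [base, neg_a]; omega) h.dvd_a
    simp only [base, neg_a, lev] at this
    omega
  have h1 := Int.eq_zero_of_abs_lt_dvd hcong.dvd_a
    (by simp only [base, lev]; rw [abs_lt]; constructor <;> omega)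
  have h2 := Int.eq_zero_of_abs_lt_dvd
    (int_dvd_of_cast_dvd Q (k := v.c - (base Q).c) (by simpa using hcong.2.2))
    (by simp only [base, lev]; rw [abs_lt]; constructor <;> omega)
  simp only [base] at h1 h2
  have h3 : v.a = -1 := by omega
  have h4 : v.c = Q.D := by omega
  refine HermForm.ext h3 (Q.eq_zero_of_nm _ ?_) h4
  rw [h3, h4] at hdet
  omega

variable [IsDomain R]

theorem crossing_col {g h : SL(2, R)} (h0 : g 0 0 = h 0 0) (h1 : g 1 0 = h 1 0) :
    (wallSystem Q).crossing label g h = 1 :=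
  WallSystem.crossing_eq_one fun v _ hv => by
    change 0 < v.ev (g 0 0) (g 1 0)
    rw [h0, h1]
    exact hv

theorem crossing_rot {g : SL(2, R)} (hg : g ∈ Gam R (lev Q)) :
    (wallSystem Q).crossing label g (g * rot) = label ((base Q).act g⁻¹) := by
  rw [WallSystem.crossing, ← descProd_singleton label]
  congr
  ext v
  have hpos1 : PosAt v g ↔ 0 < (v.act g).a := by
    rw [← ev_one_zero, ev_act]
    simp [PosAt]
  have hpos2 : PosAt v (g * rot) ↔ 0 < (v.act g).c := by
    rw [← posAt_act, ← ev_zero_one]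
    simp [PosAt, rot]
  change IsWall v ∧ ¬ PosAt v g ∧ PosAt v (g * rot) ↔ v = _
  rw [hpos1, hpos2]
  constructor
  · rintro ⟨hv, h1, h2⟩
    rw [← eq_base (hv.act hg) (not_lt.1 h1) h2, act_act, mul_inv_cancel, act_one]
  · rintro rfl
    have hD := Q.three_le_D
    refine ⟨isWall_base.act (inv_mem hg), ?_⟩
    simp only [act_act, inv_mul_cancel, act_one, base]
    omega

theorem crossing_smul {g : SL(2, R)} (hg : g ∈ Gam R (lev Q ^ 2)) (x y : SL(2, R)) :
    (wallSystem Q).crossing label (g * x) (g * y) = (wallSystem Q).crossing label x y := by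
  have hg' := inv_mem (gam_le lev_dvd_sq hg)
  refine WallSystem.crossing_map (w := wallSystem Q) (f := actIso g⁻¹)
    (fun v => isWall_act_iff hg') (fun v x => ?_) (fun v _ => label_congr (congr_act (inv_mem hg) v)) x y
  change PosAt (v.act g⁻¹) (g * x) ↔ PosAt v x
  rw [posAt_act, inv_mul_cancel_left]

theorem crossing_mul (x y z : SL(2, R)) : (wallSystem Q).crossing label x y *
    (wallSystem Q).crossing label y z = (wallSystem Q).crossing label x z :=
  WallSystem.crossing_mul_crossing (fun v _ => label_neg v) x y z

theorem crossing_symm (x y : SL(2, R)) : (wallSystem Q).crossing label y x =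
    ((wallSystem Q).crossing label x y)⁻¹ :=
  WallSystem.crossing_symm (fun v _ => label_neg v) x y

variable (Q) in
/-- The homomorphism from a congruence subgroup to a free group given by wall crossings. -/
noncomputable def crossingHom : Gam R (lev Q ^ 2) →* FreeGroup Bool where
  toFun g := (wallSystem Q).crossing label 1 g
  map_one' := crossing_col rfl rfl
  map_mul' g h := by
    rw [← crossing_mul 1 g, Subgroup.coe_mul]
    nth_rewrite 2 [← mul_one (g : SL(2, R))]
    rw [crossing_smul g.2]

theorem crossingHom_conj_unipotent {κ : SL(2, R)} (hκ : κ ∈ Gam R (lev Q ^ 2)) (h0 : κ 0 0 = 1)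
    (h1 : κ 1 0 = 0) (g : SL(2, R)) :
    ∃ h : g * κ * g⁻¹ ∈ Gam R (lev Q ^ 2), crossingHom Q ⟨_, h⟩ = 1 := by
  have h := Subgroup.Normal.conj_mem inferInstance κ hκ g
  refine ⟨h, ?_⟩
  change (wallSystem Q).crossing label 1 (g * κ * g⁻¹) = 1
  have h2 := crossing_smul h g 1
  rw [inv_mul_cancel_right, mul_one] at h2
  rw [← crossing_mul 1 g, ← crossing_mul g (g * κ), h2, crossing_symm 1 g,
    crossing_col (h := g * κ)]
  · group
  · simp [Matrix.mul_apply, Fin.sum_univ_two, h0, h1]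
  · simp [Matrix.mul_apply, Fin.sum_univ_two, h0, h1]

theorem crossing_step {g h : SL(2, R)} (hg : g ∈ Gam R (lev Q)) (hh : h ∈ Gam R (lev Q))
    (h0 : g 0 1 = h 0 1) (h1 : g 1 1 = h 1 1) : (wallSystem Q).crossing label g h =
      label ((base Q).act g⁻¹) * (label ((base Q).act h⁻¹))⁻¹ := by
  rw [← crossing_mul g (g * rot) h, ← crossing_mul (g * rot) (h * rot) h, crossing_rot hg,
    crossing_symm h, crossing_rot hh, crossing_col, one_mul] <;>
  · simp only [mul_entry, h0, h1]
    simp [rot]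

theorem exists_crossingHom_eq (z : ℤ) (hz : z = 1 ∨ z = 2) : ∃ g, crossingHom Q g =
    label (Q := Q) ⟨-1, lev Q * z, Q.D⟩ := by
  have hD := Q.three_le_D
  let N : R := lev Q
  let g₁ : SL(2, R) := upper (N * z)
  let g₂ := g₁ * lower N
  let g₃ := g₂ * upper (-(N * z))
  let g₄ := g₃ * lower (-N)
  have hg₁ : g₁ ∈ Gam R (lev Q) := upper_mem (dvd_mul_right _ _)
  have hg₂ : g₂ ∈ Gam R (lev Q) := mul_mem hg₁ (lower_mem dvd_rfl)
  have hg₃ : g₃ ∈ Gam R (lev Q) := mul_mem hg₂ (upper_mem (dvd_neg.2 (dvd_mul_right _ _)))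
  have hg₄ : g₄ ∈ Gam R (lev Q ^ 2) := by
    refine mem_gam_iff.2 ⟨⟨z + N ^ 2 * z ^ 2, ?_⟩, ⟨-N * z ^ 2, ?_⟩, ⟨N * z, ?_⟩, ⟨-z, ?_⟩⟩ <;>
    · simp [g₄, g₃, g₂, g₁, mul_entry, N]
      ring
  refine ⟨⟨g₄, hg₄⟩, ?_⟩
  change (wallSystem Q).crossing label 1 g₄ = _
  rw [← crossing_mul 1 g₁, ← crossing_mul g₁ g₂, ← crossing_mul g₂ g₃,
    crossing_col (g := 1), crossing_step hg₁ hg₂, crossing_col (g := g₂),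
    crossing_step hg₃ (gam_le lev_dvd_sq hg₄), label_act_inv hg₂ (m := z - Q.D),
    label_act_inv hg₃ (m := - Q.D), label_act_inv (gam_le lev_dvd_sq hg₄) (m := 0),
    label_congr (Q := Q) (w := ⟨-1, lev Q * z, Q.D⟩)]
  · simp
  · refine ⟨?_, ?_, ⟨-z ^ 2, ?_⟩⟩
    · simp [act, base, g₁, upper_inv]
    · simp [act_inv_b, g₁, N]
    · simp [act, ev_cast, base, g₁, upper_inv, N]
      ring
  · refine ⟨-N * z ^ 2 * (1 - N ^ 2 * z) - Q.D * N * z * (1 + N ^ 2 * z + N ^ 4 * z ^ 2), ?_⟩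
    simp [g₄, g₃, g₂, g₁, mul_entry, N]
    ring
  · exact not_lev_dvd (by omega) (by rw [lev, abs_lt]; omega)
  · exact not_lev_dvd (by omega) (by rw [lev, abs_lt]; omega)
  · refine ⟨-N * z ^ 2 * (1 - N ^ 2 * z) - Q.D * N * z, ?_⟩
    simp [g₃, g₂, g₁, mul_entry, N]
    ring
  · exact not_lev_dvd (by omega) (by rw [lev, abs_lt]; omega)
  · exact not_lev_dvd (by omega) (by rw [lev, abs_lt]; omega)
  · refine ⟨-Q.D * N * z, ?_⟩
    simp [g₂, g₁, mul_entry, N]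
    ring
  · exact not_lev_dvd (by omega) (by rw [lev, abs_lt]; omega)
  · exact not_lev_dvd (by omega) (by rw [lev, abs_lt]; omega)
  all_goals simp [g₄, g₃, g₂, g₁, mul_entry]

theorem crossingHom_surjective : Function.Surjective (crossingHom Q) := by
  have hl : lev Q = 2 * Q.D + 1 := rfl
  have hD := Q.three_le_D
  have h1 : label (Q := Q) ⟨-1, lev Q * (1 : ℤ), Q.D⟩ = FreeGroup.of true := by
    rw [label_eq_preLabel, preLabel, if_pos]
    · simp [Congr]
    · simp [Congr, base]
  have h2 : label (Q := Q) ⟨-1, lev Q * (2 : ℤ), Q.D⟩ = FreeGroup.of false := by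
    rw [label_eq_preLabel, preLabel, if_neg, if_pos]
    · simp [Congr]
    · rintro ⟨-, h, -⟩
      have h3 : lev Q ^ 2 ∣ lev Q * 1 := by
        refine int_dvd_of_cast_dvd Q ?_
        convert h using 1
        push_cast
        ring
      rw [sq] at h3
      exact not_lev_dvd one_ne_zero (by rw [abs_one]; omega)
        (Int.dvd_of_mul_dvd_mul_left (by omega) h3)
    · simp [Congr, base]
  rw [← MonoidHom.range_eq_top, eq_top_iff, ← FreeGroup.closure_range_of, Subgroup.closure_le]
  rintro _ ⟨_ | _, rfl⟩
  · rw [← h2]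
    exact exists_crossingHom_eq 2 (Or.inr rfl)
  · rw [← h1]
    exact exists_crossingHom_eq 1 (Or.inl rfl)

theorem infinite_traceSetPM (Q : ImaginaryConj R) : {Γ : Subgroup SL(2, R) | Γ.FiniteIndex ∧
    traceSetPM Γ = traceSetPM (⊤ : Subgroup SL(2, R))}.Infinite := by
  have hl : lev Q ^ 2 ≠ 0 := pow_ne_zero _ (by have := Q.three_le_D; rw [lev]; omega)
  have := gam_finiteIndex Q hl
  have := Q.finite_quotient _ hl
  let I : Ideal R := Ideal.span {((lev Q ^ 2 : ℤ) : R)}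
  refine (Subgroup.infinite_finiteIndex_conj_mem (crossingHom_surjective (Q := Q))
    (T := Set.range companion) (I := Set.range fun c : R ⧸ I => companion c.out)
    (Set.finite_range _) ?_).mono fun H hH => ⟨hH.1, ?_⟩
  · rintro _ ⟨t, rfl⟩
    have ht : ((lev Q ^ 2 : ℤ) : R) ∣ t - (Ideal.Quotient.mk I t).out :=
      dvd_sub_iff.2 (Ideal.Quotient.mk_out _).symm
    refine ⟨upper (t - (Ideal.Quotient.mk I t).out), _, ⟨Ideal.Quotient.mk I t, rfl⟩, ?_,
      crossingHom_conj_unipotent (upper_mem ht) rfl rfl⟩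
    rw [← companion_add, sub_add_cancel]
  · rw [traceSetPM_eq_univ hH.2, traceSetPM_eq_univ fun t _ => ⟨1, Subgroup.mem_top _⟩]

end HermForm

section ThreeModFour

theorem Nat.exists_prime_dvd_of_mod_four {n : ℕ} (hn : n % 4 = 3) :
    ∃ p, p.Prime ∧ p ∣ n ∧ p % 4 = 3 := by
  induction n using Nat.strong_induction_on with
  | _ n ih =>
    have hp := Nat.minFac_prime (n := n) (by omega)
    obtain ⟨m, hm⟩ := Nat.minFac_dvd n
    set p := n.minFac
    have hmod : (p % 4) * (m % 4) % 4 = 3 := by rw [← Nat.mul_mod, ← hm, hn]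
    have h1 := Nat.mod_lt p (show 4 > 0 by norm_num)
    have h2 := Nat.mod_lt m (show 4 > 0 by norm_num)
    by_cases h3 : p % 4 = 3
    · exact ⟨p, hp, ⟨m, hm⟩, h3⟩
    · have h4 : m % 4 = 3 := by
        generalize p % 4 = a at *
        generalize m % 4 = b at *
        interval_cases a <;> omega
      have h5 : m < n := by
        rw [hm]
        exact lt_mul_left (by omega) hp.one_lt
      obtain ⟨q, hq, hqm, hq3⟩ := ih m h5 h4
      exact ⟨q, hq, hm ▸ hqm.mul_left p, hq3⟩

variable {p : ℕ} {d : ℤ}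

theorem Int.dvd_of_dvd_form (hp : p.Prime) (hp3 : p % 4 = 3) (hpd : (p : ℤ) ∣ 4 * d - 1) {x y : ℤ}
    (h : (p : ℤ) ∣ d * x ^ 2 + y ^ 2) : (p : ℤ) ∣ x ∧ (p : ℤ) ∣ y := by
  have : Fact p.Prime := ⟨hp⟩
  have h1 : (x : ZMod p) ^ 2 = -(2 * y : ZMod p) ^ 2 := by
    have h2 := (ZMod.intCast_zmod_eq_zero_iff_dvd _ p).2 h
    have h3 := (ZMod.intCast_zmod_eq_zero_iff_dvd _ p).2 hpd
    push_cast at h2 h3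
    linear_combination 4 * h2 - x ^ 2 * h3
  have hx : (x : ZMod p) = 0 := by
    by_contra h0
    exact ZMod.mod_four_ne_three_of_sq_eq_neg_sq h0 h1 hp3
  have hpx := (ZMod.intCast_zmod_eq_zero_iff_dvd _ p).1 hx
  refine ⟨hpx, (Nat.prime_iff_prime_int.1 hp).dvd_of_dvd_pow (n := 2) ?_⟩
  exact (dvd_add_right ((dvd_pow hpx two_ne_zero).mul_left d)).1 h

theorem Int.eq_zero_of_form_eq (hp : p.Prime) (hp3 : p % 4 = 3) (hpd : (p : ℤ) ∣ 4 * d - 1)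
    {x y z w : ℤ} (h : d * x ^ 2 + y ^ 2 = p * (d * z ^ 2 + w ^ 2)) : z = 0 ∧ w = 0 := by
  induction hn : z.natAbs + w.natAbs using Nat.strong_induction_on generalizing x y z w with
  | _ n ih =>
    have hp0 : (p : ℤ) ≠ 0 := by exact_mod_cast hp.ne_zero
    obtain ⟨⟨x, rfl⟩, ⟨y, rfl⟩⟩ := Int.dvd_of_dvd_form hp hp3 hpd ⟨_, h⟩
    have h1 : d * z ^ 2 + w ^ 2 = p * (d * x ^ 2 + y ^ 2) :=
      mul_left_cancel₀ hp0 (by linear_combination -h)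
    obtain ⟨⟨z, rfl⟩, ⟨w, rfl⟩⟩ := Int.dvd_of_dvd_form hp hp3 hpd ⟨_, h1⟩
    have h2 : d * x ^ 2 + y ^ 2 = p * (d * z ^ 2 + w ^ 2) :=
      mul_left_cancel₀ hp0 (by linear_combination -h1)
    rcases Nat.eq_zero_or_pos (z.natAbs + w.natAbs) with h0 | h0
    · have hz : z = 0 := by omega
      have hw : w = 0 := by omega
      simp [hz, hw]
    · obtain ⟨hz, hw⟩ := ih (z.natAbs + w.natAbs) (by
        rw [← hn, Int.natAbs_mul, Int.natAbs_mul, ← mul_add, Int.natAbs_natCast]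
        exact lt_mul_left h0 hp.one_lt) h2 rfl
      simp [hz, hw]

end ThreeModFour

namespace ImaginaryQuadratic

variable {K : Type*} [Field K] {d : ℕ} {α : K}

section Coordinates

variable [CharZero K]

theorem exists_coords (hα : α ^ 2 = -(d : K)) (hgen : Algebra.adjoin ℚ {α} = ⊤) (x : K) :
    ∃ u v : ℚ, x = u + v * α := by
  have hx : x ∈ Algebra.adjoin ℚ {α} := hgen ▸ Algebra.mem_top
  induction hx using Algebra.adjoin_induction with
  | mem x hx => exact ⟨0, 1, by rw [Set.mem_singleton_iff.1 hx]; simp⟩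
  | algebraMap r => exact ⟨r, 0, by simp⟩
  | add x y _ _ hx hy =>
    obtain ⟨u, v, rfl⟩ := hx
    obtain ⟨u', v', rfl⟩ := hy
    exact ⟨u + u', v + v', by push_cast; ring⟩
  | mul x y _ _ hx hy =>
    obtain ⟨u, v, rfl⟩ := hx
    obtain ⟨u', v', rfl⟩ := hy
    exact ⟨u * u' - d * v * v', u * v' + v * u', by push_cast; linear_combination v * v' * hα⟩

theorem coords_unique (hα : α ^ 2 = -(d : K)) (hd : 0 < d) {u v u' v' : ℚ}
    (h : (u + v * α : K) = u' + v' * α) : u = u' ∧ v = v' := by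
  have h1 : ((u - u' : ℚ) : K) = -((v - v' : ℚ) : K) * α := by push_cast; linear_combination h
  have h2 : (u - u') ^ 2 + d * (v - v') ^ 2 = 0 := by
    have : (((u - u') ^ 2 + d * (v - v') ^ 2 : ℚ) : K) = 0 := by
      push_cast at h1 ⊢
      linear_combination (u - u' - (v - v') * α : K) * h1 + (v - v' : K) ^ 2 * hα
    exact_mod_cast this
  have hd' : (0 : ℚ) < d := by exact_mod_cast hd
  have h3 := mul_nonneg hd'.le (sq_nonneg (v - v'))
  have h4 : (u - u') ^ 2 = 0 := by nlinarith [sq_nonneg (u - u')]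
  have h5 : (v - v') ^ 2 = 0 := by
    rw [h4, zero_add] at h2
    exact (mul_eq_zero.1 h2).resolve_left hd'.ne'
  exact ⟨sub_eq_zero.1 (pow_eq_zero_iff two_ne_zero |>.1 h4),
    sub_eq_zero.1 (pow_eq_zero_iff two_ne_zero |>.1 h5)⟩

theorem exists_conj (hα : α ^ 2 = -(d : K)) (hd : 0 < d) (hgen : Algebra.adjoin ℚ {α} = ⊤) :
    ∃ σ : K →+* K, ∀ u v : ℚ, σ (u + v * α) = u - v * α := by
  choose u v huv using exists_coords hα hgen
  have key {x : K} {a b : ℚ} (h : x = a + b * α) : (u x - v x * α : K) = a - b * α := by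
    obtain ⟨h1, h2⟩ := coords_unique hα hd ((huv x).symm.trans h)
    rw [h1, h2]
  refine ⟨⟨⟨⟨fun x => u x - v x * α, ?_⟩, ?_⟩, ?_, ?_⟩, fun a b => key rfl⟩
  · rw [key (a := 1) (b := 0)] <;> simp
  · intro x y
    change (u (x * y) - v (x * y) * α : K) = (u x - v x * α) * (u y - v y * α)
    rw [key (a := u x * u y - d * v x * v y) (b := u x * v y + v x * u y)]
    · push_cast
      linear_combination -(v x * v y : K) * hα
    · nth_rewrite 1 [huv x, huv y]
      push_cast
      linear_combination (v x * v y : K) * hα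
  · change (u 0 - v 0 * α : K) = 0
    rw [key (a := 0) (b := 0)] <;> simp
  · intro x y
    change (u (x + y) - v (x + y) * α : K) = (u x - v x * α) + (u y - v y * α)
    rw [key (a := u x + u y) (b := v x + v y)]
    · push_cast
      ring
    · nth_rewrite 1 [huv x, huv y]
      push_cast
      ring

theorem exists_int_of_isIntegral {x : K} {q : ℚ} (h : IsIntegral ℤ x) (hx : x = q) :
    ∃ n : ℤ, (n : ℚ) = q := by
  rw [hx] at h
  exact IsIntegrallyClosed.isIntegral_iff.1
    ((isIntegral_algebraMap_iff (algebraMap ℚ K).injective).1 (by simpa using h))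

end Coordinates

theorem nonempty_imaginaryConj [NumberField K] (hα : α ^ 2 = -(d : K)) (hd : 0 < d)
    (hgen : Algebra.adjoin ℚ {α} = ⊤) : Nonempty (ImaginaryConj (𝓞 K)) := by
  obtain ⟨p, hp, hpd, hp3⟩ := Nat.exists_prime_dvd_of_mod_four (n := 4 * d - 1) (by omega)
  have hpd' : (p : ℤ) ∣ 4 * d - 1 := by
    have := Int.natCast_dvd_natCast.2 hpd
    rwa [Nat.cast_sub (by omega), Nat.cast_mul, Nat.cast_ofNat, Nat.cast_one] at this
  obtain ⟨σ, hσ⟩ := exists_conj hα hd hgen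
  have hαint : IsIntegral ℤ α := by
    refine IsIntegral.of_pow two_pos ?_
    rw [hα]
    simpa using isIntegral_algebraMap (R := ℤ) (A := K) (x := -(d : ℤ))
  choose u v huv using fun x : 𝓞 K => exists_coords hα hgen x
  have hσx (x : 𝓞 K) : σ x = u x - v x * α := by rw [← hσ, ← huv]
  have hσint (x : 𝓞 K) : IsIntegral ℤ (σ x) := map_isIntegral_int σ x.2
  have hnm (x : 𝓞 K) : ∃ n : ℤ, (n : ℚ) = u x ^ 2 + d * v x ^ 2 := by
    refine exists_int_of_isIntegral (x := (x : K) * σ x) (x.2.mul (hσint x)) ?_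
    rw [hσx, huv]
    push_cast
    linear_combination -(v x : K) ^ 2 * hα
  have htr (x : 𝓞 K) : ∃ n : ℤ, (n : ℚ) = 2 * u x := by
    refine exists_int_of_isIntegral (x := (x : K) + σ x) (x.2.add (hσint x)) ?_
    rw [hσx, huv]
    push_cast
    ring
  have he (x : 𝓞 K) : ∃ n : ℤ, (n : ℚ) = -(2 * d * v x) := by
    refine exists_int_of_isIntegral (x := ((x : K) - σ x) * α) ((x.2.sub (hσint x)).mul hαint) ?_
    rw [hσx, huv]
    push_cast
    linear_combination 2 * (v x : K) * hα
  choose nm hnm using hnm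
  choose tr htr using htr
  choose e he using he
  have hform (x : 𝓞 K) : d * tr x ^ 2 + e x ^ 2 = 4 * d * nm x := by
    have : (d * tr x ^ 2 + e x ^ 2 : ℚ) = 4 * d * nm x := by
      rw [hnm, htr, he]
      ring
    exact_mod_cast this
  have hd' : (0 : ℚ) < d := by exact_mod_cast hd
  have hinj {x y : 𝓞 K} (h1 : tr x = tr y) (h2 : e x = e y) : x = y := by
    have h1' : (tr x : ℚ) = tr y := by rw [h1]
    have h2' : (e x : ℚ) = e y := by rw [h2]
    rw [htr, htr] at h1'
    rw [he, he, neg_inj] at h2'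
    apply RingOfIntegers.ext
    rw [huv x, huv y, mul_left_cancel₀ two_ne_zero h1',
      mul_left_cancel₀ (mul_ne_zero two_ne_zero hd'.ne') h2']
  have hnm_cast (x : 𝓞 K) : (nm x : K) = u x ^ 2 + d * v x ^ 2 := by
    exact_mod_cast congrArg (Rat.cast (K := K)) (hnm x)
  have htr_cast (x : 𝓞 K) : (tr x : K) = 2 * u x := by
    exact_mod_cast congrArg (Rat.cast (K := K)) (htr x)
  have hnonneg (x : 𝓞 K) : 0 ≤ nm x := by
    have : (0 : ℚ) ≤ nm x := by
      rw [hnm]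
      positivity
    exact_mod_cast this
  have hd1 : (1 : ℤ) ≤ d := by exact_mod_cast hd
  have hzero {x : 𝓞 K} (h1 : tr x = 0) (h2 : e x = 0) : x = 0 := by
    have hu : u x = 0 := by simpa [h1] using htr x
    have hv : v x = 0 := by simpa [h2, hd.ne'] using he x
    apply RingOfIntegers.ext
    rw [huv, hu, hv]
    simp
  exact ⟨{
    conj := RingOfIntegers.mapRingHom σ
    nm := nm
    tr := tr
    D := p
    conj_conj := fun x => by
      apply RingOfIntegers.ext
      have := hσ (u x) (-v x)
      rw [Rat.cast_neg, neg_mul, ← sub_eq_add_neg, sub_neg_eq_add] at this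
      rw [RingOfIntegers.mapRingHom_apply, RingOfIntegers.mapRingHom_apply, hσx, this, ← huv]
    nm_cast := fun x => by
      apply RingOfIntegers.coe_injective
      rw [map_intCast, map_mul]
      change (nm x : K) = x * σ x
      rw [hσx, huv, hnm_cast]
      linear_combination (v x : K) ^ 2 * hα
    tr_cast := fun x => by
      apply RingOfIntegers.coe_injective
      rw [map_intCast, map_add]
      change (tr x : K) = x + σ x
      rw [hσx, huv, htr_cast]
      ring
    nm_nonneg := hnonneg
    eq_zero_of_nm := fun x hx => by
      have := hform x
      rw [hx] at this
      exact hzero (by nlinarith) (by nlinarith)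
    finite_nm_le := fun B => by
      refine Set.Finite.of_finite_image (f := fun x => (tr x, e x))
        (((Set.finite_Icc (-(4 * d * B)) (4 * d * B)).prod
          (Set.finite_Icc (-(4 * d * B)) (4 * d * B))).subset ?_)
        fun x _ y _ h => hinj (congrArg Prod.fst h) (congrArg Prod.snd h)
      rintro _ ⟨x, hx, rfl⟩
      have h1 := hform x
      have h2 : nm x ≤ B := hx
      have h3 : 4 * d * nm x ≤ 4 * d * B := by gcongr
      have h4 (k : ℤ) (hk : k ^ 2 ≤ 4 * d * B) : k ∈ Set.Icc (-(4 * d * B)) (4 * d * B) := by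
        constructor <;> nlinarith [Int.le_self_sq k, Int.le_self_sq (-k)]
      exact ⟨h4 _ (by nlinarith [sq_nonneg (tr x), sq_nonneg (e x)]),
        h4 _ (by nlinarith [sq_nonneg (tr x), sq_nonneg (e x)])⟩
    finite_quotient := fun n hn =>
      Ring.HasFiniteQuotients.finiteQuotient (by simpa using hn)
    three_le_D := by omega
    eq_zero_of_nm_eq := fun x y h => by
      have h1 := hform x
      have h2 := hform y
      obtain ⟨h3, h4⟩ := Int.eq_zero_of_form_eq hp hp3 hpd' (x := tr x) (y := e x) (z := tr y)
        (w := e y) (by rw [h1, h2, h]; ring)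
      exact hzero h3 h4 }⟩

end ImaginaryQuadratic

/-- For `K = ℚ(√-d)` an imaginary quadratic field with ring of integers `𝓞`, there are
infinitely many finite-index subgroups of `SL(2, 𝓞)` with the same trace set up to sign as
`SL(2, 𝓞)` itself. -/
theorem infinite_finite_index_subgroups_bianchi_trace_set
    (d : ℕ) (hd : Squarefree d) (hd0 : 0 < d)
    (K : Type*) [Field K] [NumberField K] (α : K) (hα : α ^ 2 = -(d : K))
    (hgen : Algebra.adjoin ℚ {α} = ⊤) :
    {Γ : Subgroup (Matrix.SpecialLinearGroup (Fin 2) (𝓞 K)) | Γ.FiniteIndex ∧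
      traceSetPM Γ = traceSetPM (⊤ : Subgroup (Matrix.SpecialLinearGroup (Fin 2) (𝓞 K)))
      }.Infinite := by
  obtain ⟨Q⟩ := ImaginaryQuadratic.nonempty_imaginaryConj hα hd0 hgen
  exact HermForm.infinite_traceSetPM Q
end

section
/- Let d be a square-free positive integer, let K = ℚ(√-d) be the imaginary quadratic field obtained by adjoining a square root of -d to ℚ, and let 𝓞 be the ring of integers of K. Then there exists a finitely generated subgroup H of SL(2,𝓞) which has infinite index in SL(2,𝓞) and whose trace set up to sign equals that of SL(2,𝓞): {t ∈ 𝓞 : ∃ γ ∈ H, tr γ = t or tr γ = -t} = {t ∈ 𝓞 : ∃ γ ∈ SL(2,𝓞), tr γ = t or tr γ = -t}. -/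
open scoped MatrixGroups
open NumberField

/-- `IsReducedWord Z A i g` says that `g` is a nonempty product of elements of the subgroups `A j`
lying outside `Z`, consecutive factors coming from different subgroups and the first from `A i`. -/
inductive IsReducedWord {G ι : Type*} [Group G] (Z : Subgroup G) (A : ι → Subgroup G) :
    ι → G → Prop
  | single (i : ι) (k : G) (hk : k ∈ A i) (hkZ : k ∉ Z) : IsReducedWord Z A i k
  | cons (i j : ι) (k h : G) (hk : k ∈ A i) (hkZ : k ∉ Z) (hij : i ≠ j)
      (hh : IsReducedWord Z A j h) : IsReducedWord Z A i (k * h)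

section PingPong

variable {G ι : Type*} [Group G] {Z : Subgroup G} {A : ι → Subgroup G}

theorem IsReducedWord.mul_left (hZ : ∀ i, Z ≤ A i) {i : ι} {h z : G} (hz : z ∈ Z)
    (hh : IsReducedWord Z A i h) : IsReducedWord Z A i (z * h) := by
  cases hh with
  | single _ k hk hkZ =>
    exact .single i _ (mul_mem (hZ i hz) hk) (by rwa [Subgroup.mul_mem_cancel_left _ hz])
  | cons _ j k h hk hkZ hij hh =>
    rw [← mul_assoc]
    exact .cons i j _ h (mul_mem (hZ i hz) hk) (by rwa [Subgroup.mul_mem_cancel_left _ hz]) hij hh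

theorem mem_or_isReducedWord_of_mem {i : ι} {x : G} (hx : x ∈ A i) :
    x ∈ Z ∨ ∃ i, IsReducedWord Z A i x := by
  by_cases h : x ∈ Z
  · exact .inl h
  · exact .inr ⟨i, .single i x hx h⟩

theorem mem_or_isReducedWord_mul (hZ : ∀ i, Z ≤ A i) {i : ι} {x h : G} (hx : x ∈ A i)
    (hh : h ∈ Z ∨ ∃ i, IsReducedWord Z A i h) :
    x * h ∈ Z ∨ ∃ i, IsReducedWord Z A i (x * h) := by
  rcases hh with hh | ⟨j, hh⟩
  · exact mem_or_isReducedWord_of_mem (mul_mem hx (hZ i hh))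
  by_cases hxZ : x ∈ Z
  · exact .inr ⟨j, hh.mul_left hZ hxZ⟩
  by_cases hij : i = j
  · subst hij
    cases hh with
    | single _ k hk hkZ => exact mem_or_isReducedWord_of_mem (mul_mem hx hk)
    | cons _ j k h hk hkZ hij hh =>
      rw [← mul_assoc]
      by_cases hxk : x * k ∈ Z
      · exact .inr ⟨j, hh.mul_left hZ hxk⟩
      · exact .inr ⟨i, .cons i j _ h (mul_mem hx hk) hxk hij hh⟩
  · exact .inr ⟨i, .cons i j x h hx hxZ hij hh⟩

theorem mem_or_isReducedWord_of_mem_iSup (hZ : ∀ i, Z ≤ A i) {g : G} (hg : g ∈ ⨆ i, A i) :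
    g ∈ Z ∨ ∃ i, IsReducedWord Z A i g := by
  suffices H : ∀ h, (h ∈ Z ∨ ∃ i, IsReducedWord Z A i h) →
      (g * h ∈ Z ∨ ∃ i, IsReducedWord Z A i (g * h)) by
    simpa using H 1 (.inl (one_mem Z))
  refine Subgroup.iSup_induction A (C := fun g => ∀ h, (h ∈ Z ∨ ∃ i, IsReducedWord Z A i h) →
    (g * h ∈ Z ∨ ∃ i, IsReducedWord Z A i (g * h))) hg (fun i x hx h hh => ?_) (by simp)
    fun x y hx hy h hh => ?_
  · exact mem_or_isReducedWord_mul hZ hx hh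
  · rw [mul_assoc]
    exact hx _ (hy _ hh)

/-- The ping-pong lemma relative to a subgroup `Z`, for the action of `G` on itself. -/
theorem mem_or_mul_mem_of_pingPong (hZ : ∀ i, Z ≤ A i) {X : ι → Set G} {P : Set G}
    (hP : ∀ i, ∀ p ∈ P, p ∉ X i) (hX : ∀ i j, i ≠ j → ∀ x ∈ X j, x ∉ X i)
    (hA : ∀ i, ∀ k ∈ A i, k ∉ Z → ∀ x ∉ X i, k * x ∈ X i) {g : G} (hg : g ∈ ⨆ i, A i) :
    g ∈ Z ∨ ∃ i, ∀ p ∈ P, g * p ∈ X i := by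
  obtain h | ⟨i, hi⟩ := mem_or_isReducedWord_of_mem_iSup hZ hg
  · exact .inl h
  refine .inr ⟨i, fun p hp => ?_⟩
  clear hg
  induction hi with
  | single i k hk hkZ => exact hA i k hk hkZ p (hP i p hp)
  | cons i j k h hk hkZ hij hh ih =>
    rw [mul_assoc]
    exact hA i k hk hkZ _ (hX i j hij _ ih)

end PingPong

section SpecialLinearGroup

variable {R : Type*} [CommRing R]

theorem mem_center_SL2_iff {g : SL(2, R)} :
    g ∈ Subgroup.center SL(2, R) ↔ g 1 0 = 0 ∧ g 0 1 = 0 ∧ g 0 0 = g 1 1 := by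
  rw [Matrix.SpecialLinearGroup.mem_center_iff]
  constructor
  · rintro ⟨r, -, hr⟩
    simp [← hr]
  · rintro ⟨h10, h01, h00⟩
    have hdet := g.det_coe
    rw [Matrix.det_fin_two, h01, h00] at hdet
    refine ⟨g 1 1, by simpa [pow_two] using hdet, ?_⟩
    ext i j
    fin_cases i <;> fin_cases j <;> simp [h10, h01, h00]

theorem SL2_mul_apply (g h : SL(2, R)) (i j : Fin 2) :
    (g * h) i j = g i 0 * h 0 j + g i 1 * h 1 j := by
  rw [Matrix.SpecialLinearGroup.coe_mul, Matrix.mul_apply, Fin.sum_univ_two]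

/-- The matrices `!![1, x; 0, 1]`. -/
def upperUnipotent : Multiplicative R →* SL(2, R) where
  toFun x := ⟨!![1, x.toAdd; 0, 1], by simp⟩
  map_one' := by ext i j; fin_cases i <;> fin_cases j <;> simp
  map_mul' x y := by
    ext i j
    refine Eq.trans ?_ (SL2_mul_apply _ _ i j).symm
    fin_cases i <;> fin_cases j <;> simp [add_comm]

theorem coe_upperUnipotent (x : Multiplicative R) :
    (upperUnipotent x : Matrix (Fin 2) (Fin 2) R) = !![1, x.toAdd; 0, 1] := rfl

/-- The unipotent matrices fixing the cusp `q`. -/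
def unipotentAt (q : R) : Multiplicative R →* SL(2, R) where
  toFun x := ⟨!![1 + q * x.toAdd, -(q ^ 2 * x.toAdd); x.toAdd, 1 - q * x.toAdd], by
    rw [Matrix.det_fin_two_of]; ring⟩
  map_one' := by ext i j; fin_cases i <;> fin_cases j <;> simp
  map_mul' x y := by
    ext i j
    refine Eq.trans ?_ (SL2_mul_apply _ _ i j).symm
    fin_cases i <;> fin_cases j <;> simp <;> ring

theorem coe_unipotentAt (q : R) (x : Multiplicative R) :
    (unipotentAt q x : Matrix (Fin 2) (Fin 2) R) =
      !![1 + q * x.toAdd, -(q ^ 2 * x.toAdd); x.toAdd, 1 - q * x.toAdd] := rfl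

/-- The companion matrix `!![t, -1; 1, 0]`, of trace `t`. -/
def companionSL (t : R) : SL(2, R) := ⟨!![t, -1; 1, 0], by simp⟩

theorem coe_companionSL (t : R) :
    (companionSL t : Matrix (Fin 2) (Fin 2) R) = !![t, -1; 1, 0] := rfl

/-- The matrices `±!![1, x; 0, 1]` with `x` divisible by `N`. -/
def pmUpperUnipotent (N : R) : Subgroup SL(2, R) where
  carrier := {g | g 1 0 = 0 ∧ g 0 0 = g 1 1 ∧ N ∣ g 0 1}
  one_mem' := by simp
  mul_mem' := by
    rintro a b ⟨ha, ha', ha''⟩ ⟨hb, hb', hb''⟩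
    simp only [Set.mem_ofPred_eq, SL2_mul_apply, ha, hb, ha', hb']
    exact ⟨by ring, by ring, dvd_add (hb''.mul_left _) (ha''.mul_right _)⟩
  inv_mem' := by
    rintro a ⟨ha, ha', ha''⟩
    simp [ Matrix.adjugate_fin_two, ha, ha', ha'']

theorem mem_pmUpperUnipotent {N : R} {g : SL(2, R)} :
    g ∈ pmUpperUnipotent N ↔ g 1 0 = 0 ∧ g 0 0 = g 1 1 ∧ N ∣ g 0 1 := Iff.rfl

theorem center_le_pmUpperUnipotent (N : R) : Subgroup.center SL(2, R) ≤ pmUpperUnipotent N := by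
  intro g hg
  obtain ⟨h, h', h''⟩ := mem_center_SL2_iff.1 hg
  exact ⟨h, h'', by simp [h']⟩

/-- A group containing a matrix of trace `s` for each `s` congruent to `t` modulo `N`. -/
def traceClassSubgroup (N t : R) : Subgroup SL(2, R) :=
  (upperUnipotent.comp (AddMonoidHom.toMultiplicative (AddMonoidHom.mulLeft N))).range ⊔
    Subgroup.zpowers (companionSL t)

theorem traceClassSubgroup_fg [Module.Finite ℤ R] (N t : R) : (traceClassSubgroup N t).FG := by
  have : AddGroup.FG R := Module.Finite.iff_addGroup_fg.1 inferInstance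
  have : Group.FG (Multiplicative R) := AddGroup.fg_iff_mul_fg.1 this
  exact .sup ((Group.fg_iff_subgroup_fg _).1 inferInstance)
    ⟨{companionSL t}, by simp [Subgroup.zpowers_eq_closure]⟩

theorem traceClassSubgroup_le (N t : R) :
    traceClassSubgroup N t ≤ pmUpperUnipotent N ⊔ Subgroup.centralizer {companionSL t} := by
  refine sup_le_sup ?_ ?_
  · rintro _ ⟨x, rfl⟩
    simp [mem_pmUpperUnipotent, coe_upperUnipotent]
  · simp [Subgroup.mem_centralizer_singleton_iff]

theorem exists_mem_traceClassSubgroup (N t x : R) :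
    ∃ g ∈ traceClassSubgroup N t, Matrix.trace (g : Matrix (Fin 2) (Fin 2) R) = t + N * x := by
  refine ⟨upperUnipotent (.ofAdd (N * x)) * companionSL t, mul_mem
    (Subgroup.mem_sup_left ⟨.ofAdd x, rfl⟩)
    (Subgroup.mem_sup_right (Subgroup.mem_zpowers _)), ?_⟩
  rw [Matrix.trace_fin_two, SL2_mul_apply, SL2_mul_apply]
  simp [coe_upperUnipotent, coe_companionSL]

theorem entries_of_mem_centralizer_companionSL {t : R} {g : SL(2, R)}
    (hg : g ∈ Subgroup.centralizer {companionSL t}) :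
    g 0 1 = -g 1 0 ∧ g 0 0 = g 1 1 + t * g 1 0 := by
  rw [Subgroup.mem_centralizer_singleton_iff] at hg
  have h (i j : Fin 2) := congrArg (fun M : SL(2, R) => M i j) hg
  have h00 := h 0 0
  have h10 := h 1 0
  simp only [SL2_mul_apply, coe_companionSL, Matrix.of_apply, Matrix.cons_val] at h00 h10
  exact ⟨by linear_combination h00, by linear_combination -h10⟩

theorem form_eq_one_of_mem_centralizer_companionSL {t : R} {g : SL(2, R)}
    (hg : g ∈ Subgroup.centralizer {companionSL t}) :
    g 1 1 ^ 2 + t * g 1 0 * g 1 1 + g 1 0 ^ 2 = 1 := by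
  obtain ⟨h01, h00⟩ := entries_of_mem_centralizer_companionSL hg
  have := g.det_coe
  rw [Matrix.det_fin_two, h01, h00] at this
  linear_combination this

end SpecialLinearGroup

theorem norm_lt_or_norm_sub_mul_lt {t c d z w : ℂ} (hc : 1 ≤ ‖c‖)
    (h : d ^ 2 + t * c * d + c ^ 2 = 1) (hz : 3 * ‖w‖ ≤ ‖z‖) (hzt : 3 * ‖w‖ ≤ ‖z - t * w‖)
    (hzw : z ≠ 0 ∨ w ≠ 0) :
    ‖(d + t * c) * z - c * w‖ < 3 * ‖c * z + d * w‖ ∨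
      ‖(d + t * c) * z - c * w - t * (c * z + d * w)‖ < 3 * ‖c * z + d * w‖ := by
  have hc0 : c ≠ 0 := norm_pos_iff.1 (by linarith)
  obtain ⟨s, rfl⟩ : ∃ s, d = s * c := ⟨d / c, by field_simp⟩
  have hs : ‖s‖ * ‖s + t‖ ≤ 2 := by
    have : s * (s + t) = 1 / c ^ 2 - 1 := by
      field_simp
      linear_combination h
    rw [← norm_mul, this]
    refine (norm_sub_le _ _).trans ?_
    have : ‖1 / c ^ 2‖ ≤ 1 := by
      rw [norm_div, norm_one, norm_pow, div_le_one (by positivity)]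
      exact one_le_pow₀ hc
    rw [norm_one]
    linarith
  set W := c * z + s * c * w with hW
  -- `v` is the coordinate of the point relative to the centre of a ball of radius `3`
  have key (v r : ℂ) (hr : ‖r‖ ≤ 3 / 2) (hv : 3 * ‖w‖ ≤ ‖v‖) (hv0 : v ≠ 0 ∨ w ≠ 0)
      (hvW : W = c * (v + r * w)) : ‖r * W - w / c‖ < 3 * ‖W‖ := by
    have h1 : ‖v‖ - 3 / 2 * ‖w‖ ≤ ‖v + r * w‖ := by
      have h2 := norm_sub_le (v + r * w) (r * w)
      rw [add_sub_cancel_right, norm_mul] at h2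
      nlinarith [norm_nonneg w]
    have h2 : ‖v‖ - 3 / 2 * ‖w‖ ≤ ‖W‖ := by
      rw [hvW, norm_mul]
      nlinarith [norm_nonneg (v + r * w)]
    have h3 : ‖w / c‖ ≤ ‖w‖ := by
      rw [norm_div]
      exact div_le_self (norm_nonneg _) hc
    have h4 : 0 < ‖v‖ := by
      rcases hv0 with h | h
      · exact norm_pos_iff.2 h
      · linarith [norm_pos_iff.2 h]
    have h5 := norm_sub_le (r * W) (w / c)
    rw [norm_mul] at h5
    nlinarith [norm_nonneg W, norm_nonneg w]
  by_cases hs' : ‖s‖ ≤ 3 / 2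
  · refine .inr ?_
    convert key z s hs' hz hzw (by rw [hW]; ring) using 2
    rw [hW]
    field_simp
    linear_combination (-w) * h
  · refine .inl ?_
    have hst : ‖s + t‖ ≤ 3 / 2 := by
      by_contra! h'
      nlinarith
    have hzw' : z - t * w ≠ 0 ∨ w ≠ 0 := by
      by_cases hw : w = 0
      · simpa [hw] using hzw
      · exact .inr hw
    convert key (z - t * w) (s + t) hst hzt hzw' (by rw [hW]; ring) using 2
    rw [hW]
    field_simp
    linear_combination (-w) * h

section ColumnBall

variable {R : Type*} [CommRing R] (φ : R →+* ℂ)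

/-- The matrices whose first column `(z, w)` represents a point `z / w` of the open ball of centre
`a` and radius `r`. -/
def columnBall (a : R) (r : ℝ) : Set SL(2, R) :=
  {x | ‖φ (x 0 0) - φ a * φ (x 1 0)‖ < r * ‖φ (x 1 0)‖}

variable {φ}

theorem mem_columnBall {a : R} {r : ℝ} {x : SL(2, R)} :
    x ∈ columnBall φ a r ↔ ‖φ (x 0 0) - φ a * φ (x 1 0)‖ < r * ‖φ (x 1 0)‖ := Iff.rfl

theorem columnBall_mono {a : R} {r s : ℝ} (h : r ≤ s) : columnBall φ a r ⊆ columnBall φ a s :=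
  fun _ hx => lt_of_lt_of_le hx (mul_le_mul_of_nonneg_right h (norm_nonneg _))

theorem map_column_ne_zero (φ : R →+* ℂ) (x : SL(2, R)) : φ (x 0 0) ≠ 0 ∨ φ (x 1 0) ≠ 0 := by
  by_contra! h
  have hdet := x.det_coe
  rw [Matrix.det_fin_two] at hdet
  have := congrArg φ hdet
  simp [h.1, h.2] at this

theorem notMem_columnBall_of_mem {a b : R} {r s : ℝ} (h : r + s ≤ ‖φ a - φ b‖) {x : SL(2, R)}
    (hx : x ∈ columnBall φ a r) : x ∉ columnBall φ b s := by
  intro hx'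
  rw [mem_columnBall] at hx hx'
  have h1 := norm_sub_le (φ (x 0 0) - φ b * φ (x 1 0)) (φ (x 0 0) - φ a * φ (x 1 0))
  rw [sub_sub_sub_cancel_left, ← sub_mul, norm_mul] at h1
  nlinarith [norm_nonneg (φ (x 1 0))]

theorem exists_norm_lt_of_mem_columnBall {N a b : R} {r s : ℝ} {k x : SL(2, R)}
    (hk : k ∈ pmUpperUnipotent N) (hkZ : k ∉ Subgroup.center SL(2, R))
    (hx : x ∈ columnBall φ a r) (hkx : k * x ∈ columnBall φ b s) :
    ∃ y ≠ 0, ‖φ (N * y) + φ a - φ b‖ < r + s := by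
  obtain ⟨h10, h00, y, hy⟩ := mem_pmUpperUnipotent.1 hk
  have hdet := k.det_coe
  rw [Matrix.det_fin_two, h10, h00, mul_zero, sub_zero] at hdet
  refine ⟨k 1 1 * y, fun h => hkZ (mem_center_SL2_iff.2 ⟨h10, ?_, h00⟩), ?_⟩
  · rw [hy]
    linear_combination (-(N * y)) * hdet + k 1 1 * N * h
  rw [mem_columnBall] at hx hkx
  simp only [SL2_mul_apply, h10, h00, hy, zero_mul, zero_add, map_add, map_mul] at hkx ⊢
  replace hdet := congrArg φ hdet
  rw [map_mul, map_one] at hdet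
  set u := φ (k 1 1)
  set z := φ (x 0 0)
  set w := φ (x 1 0)
  have hu : ‖u‖ = 1 := by
    have : ‖u‖ * ‖u‖ = 1 := by rw [← norm_mul, hdet, norm_one]
    nlinarith [norm_nonneg u]
  have h1 : ‖z + φ N * (u * φ y) * w - φ b * w‖ < s * ‖w‖ := by
    calc _ = ‖u * (u * z + φ N * φ y * w - φ b * (u * w))‖ := by
            congr 1
            linear_combination (φ b * w - z) * hdet
      _ < _ := by simpa [hu] using hkx
  have h2 := norm_sub_le (z + φ N * (u * φ y) * w - φ b * w) (z - φ a * w)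
  have h3 : z + φ N * (u * φ y) * w - φ b * w - (z - φ a * w) =
      (φ N * (u * φ y) + φ a - φ b) * w := by ring
  rw [h3, norm_mul] at h2
  exact lt_of_mul_lt_mul_right (by linarith) (norm_nonneg w)

theorem mul_mem_columnBall_of_mem_centralizer (hφ : ∀ x : R, x ≠ 0 → 1 ≤ ‖φ x‖) {t : R}
    {k x : SL(2, R)} (hk : k ∈ Subgroup.centralizer {companionSL t})
    (hkZ : k ∉ Subgroup.center SL(2, R))
    (hx : x ∉ columnBall φ 0 3 ∪ columnBall φ t 3) :
    k * x ∈ columnBall φ 0 3 ∪ columnBall φ t 3 := by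
  obtain ⟨h01, h00⟩ := entries_of_mem_centralizer_companionSL hk
  have hform := congrArg φ (form_eq_one_of_mem_centralizer_companionSL hk)
  have hc : k 1 0 ≠ 0 := fun h => hkZ (mem_center_SL2_iff.2 ⟨h, by simp [h01, h], by simp [h00, h]⟩)
  simp only [Set.mem_union, mem_columnBall, not_or, not_lt, map_zero, zero_mul, sub_zero,
    SL2_mul_apply, h01, h00, map_add, map_mul, map_pow, map_one, map_neg] at hx hform ⊢
  simpa only [neg_mul, ← sub_eq_add_neg] using
    norm_lt_or_norm_sub_mul_lt (hφ _ hc) hform hx.1 hx.2 (map_column_ne_zero φ x)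

theorem unipotentAt_mul_mem_columnBall {q y : R} (hy : 2 < ‖φ y‖) {x : SL(2, R)}
    (hx : x ∉ columnBall φ q 1) : unipotentAt q (.ofAdd y) * x ∈ columnBall φ q 1 := by
  have h0 := map_column_ne_zero φ x
  simp only [mem_columnBall, SL2_mul_apply, coe_unipotentAt, Matrix.of_apply, Matrix.cons_val,
    toAdd_ofAdd, map_add, map_mul, map_sub, map_neg, map_pow, map_one, not_lt, one_mul] at hx ⊢
  set z := φ (x 0 0)
  set w := φ (x 1 0)
  obtain ⟨v, hv⟩ : ∃ v, v = z - φ q * w := ⟨_, rfl⟩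
  have h1 : (1 + φ q * φ y) * z + -(φ q ^ 2 * φ y) * w - φ q * (φ y * z + (1 - φ q * φ y) * w) =
      v := by rw [hv]; ring
  have h2 : φ y * z + (1 - φ q * φ y) * w = φ y * v + w := by rw [hv]; ring
  rw [h1, h2]
  rw [← hv] at hx
  have hv0 : 0 < ‖v‖ := by
    by_contra! h
    have hw : w = 0 := norm_le_zero_iff.1 (hx.trans h)
    have hz : z = 0 := by simpa [hw, norm_le_zero_iff.1 h] using hv.symm
    simp [hw, hz] at h0
  have h3 := norm_sub_le (φ y * v + w) w
  rw [add_sub_cancel_right, norm_mul] at h3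
  nlinarith

theorem mem_center_or_mul_notMem_columnBall (hφ : ∀ x : R, x ≠ 0 → 1 ≤ ‖φ x‖) {N t q : R}
    (hN : ∀ a ∈ ({0, t, q} : Set R), ∀ b ∈ ({0, t, q} : Set R), ∀ y ≠ 0,
      6 ≤ ‖φ (N * y) + φ a - φ b‖)
    (hq : 4 ≤ ‖φ q‖) (hqt : 4 ≤ ‖φ q - φ t‖) {g : SL(2, R)}
    (hg : g ∈ pmUpperUnipotent N ⊔ Subgroup.centralizer {companionSL t}) :
    g ∈ Subgroup.center SL(2, R) ∨ ∀ p ∈ columnBall φ q 1, g * p ∉ columnBall φ q 1 := by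
  let Y := columnBall φ 0 3 ∪ columnBall φ t 3
  have hqY : ∀ x ∈ columnBall φ q 1, x ∉ Y := fun x hx => not_or.2
    ⟨notMem_columnBall_of_mem (by norm_num; exact hq) hx,
      notMem_columnBall_of_mem (by norm_num; exact hqt) hx⟩
  have hF : ∀ x ∈ Y ∪ columnBall φ q 1, ∃ a ∈ ({0, t, q} : Set R), x ∈ columnBall φ a 3 := by
    rintro x ((hx | hx) | hx)
    · exact ⟨0, by simp, hx⟩
    · exact ⟨t, by simp, hx⟩
    · exact ⟨q, by simp, columnBall_mono (by norm_num) hx⟩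
  let X : Bool → Set SL(2, R) := fun i => bif i then (Y ∪ columnBall φ q 1)ᶜ else Y
  rw [sup_eq_iSup] at hg
  refine (mem_or_mul_mem_of_pingPong (Z := Subgroup.center SL(2, R)) (X := X)
    (P := columnBall φ q 1) ?_ ?_ ?_ ?_ hg).imp_right ?_
  · rintro (_ | _)
    · exact Subgroup.center_le_centralizer _
    · exact center_le_pmUpperUnipotent N
  · rintro (_ | _) p hp
    · exact hqY p hp
    · exact fun h => h (.inr hp)
  · rintro (_ | _) (_ | _) hij x hx
    · exact absurd rfl hij
    · exact fun h => hx (.inl h)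
    · exact fun h => h (.inl hx)
    · exact absurd rfl hij
  · rintro (_ | _) k hk hkZ x hx
    · exact mul_mem_columnBall_of_mem_centralizer hφ hk hkZ hx
    · intro hkx
      obtain ⟨a, ha, hxa⟩ := hF x (not_not.1 hx)
      obtain ⟨b, hb, hkxb⟩ := hF _ hkx
      obtain ⟨y, hy, hlt⟩ := exists_norm_lt_of_mem_columnBall hk hkZ hxa hkxb
      linarith [hN a ha b hb y hy]
  · rintro ⟨_ | _, h⟩ p hp
    · exact fun h' => hqY _ h' (h p hp)
    · exact fun h' => h p hp (.inr h')

theorem unipotentAt_mul_companionSL_mem_columnBall (q y : R) :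
    unipotentAt q (.ofAdd y) * companionSL q ∈ columnBall φ q 1 := by
  have h1 : (1 + q * y) * q + -(q ^ 2 * y) * 1 = q := by ring
  have h2 : y * q + (1 - q * y) * 1 = 1 := by ring
  simp only [mem_columnBall, SL2_mul_apply, coe_unipotentAt, coe_companionSL, Matrix.of_apply,
    Matrix.cons_val, toAdd_ofAdd, h1, h2]
  simp

theorem index_iSup_map_conj_unipotentAt_eq_zero {ι : Type*} {B : ι → Subgroup SL(2, R)} (q : R)
    (hBZ : ∀ i, Subgroup.center SL(2, R) ≤ B i)
    (hB : ∀ i, ∀ g ∈ B i, g ∈ Subgroup.center SL(2, R) ∨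
      ∀ p ∈ columnBall φ q 1, g * p ∉ columnBall φ q 1)
    {n : ι → ℕ} (hn : Function.Injective n) :
    (⨆ i, (B i).map (MulAut.conj (unipotentAt q (.ofAdd (3 * n i : R)))).toMonoidHom).index
      = 0 := by
  have hmul (x y : R) : (unipotentAt q (.ofAdd x))⁻¹ * unipotentAt q (.ofAdd y) =
      unipotentAt q (.ofAdd (y - x)) := by
    rw [← map_inv, ← map_mul, ← ofAdd_neg, ← ofAdd_add, neg_add_eq_sub]
  by_contra hindex
  obtain ⟨m, hm, -, hmem⟩ := Subgroup.exists_pow_mem_of_index_ne_zero hindex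
    (unipotentAt q (.ofAdd (1 : R)))
  rw [← map_pow, ← ofAdd_nsmul, nsmul_one] at hmem
  have hpp := mem_or_mul_mem_of_pingPong (Z := Subgroup.center SL(2, R))
    (X := fun i => {x | (unipotentAt q (.ofAdd (3 * n i : R)))⁻¹ * x ∉ columnBall φ q 1})
    (P := {companionSL q}) ?_ ?_ ?_ ?_ hmem
  · rcases hpp with h | ⟨i, h⟩
    · have := congrArg φ ((mem_center_SL2_iff.1 h).1)
      simp [coe_unipotentAt] at this
      omega
    · refine h _ rfl ?_
      rw [← mul_assoc, hmul]
      exact unipotentAt_mul_companionSL_mem_columnBall q _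
  · intro i z hz
    refine ⟨z, hBZ i hz, ?_⟩
    rw [Subgroup.mem_center_iff] at hz
    simp [hz]
  · rintro i p rfl h
    refine h ?_
    rw [← map_inv, ← ofAdd_neg]
    exact unipotentAt_mul_companionSL_mem_columnBall q _
  · intro i j hij x hx h
    refine h ?_
    rw [← mul_inv_cancel_left (unipotentAt q (.ofAdd (3 * n j : R))) x, ← mul_assoc, hmul]
    refine unipotentAt_mul_mem_columnBall ?_ hx
    obtain ⟨k, hk⟩ : ∃ k : ℤ, (n j : ℤ) - n i = k := ⟨_, rfl⟩
    have hk0 : k ≠ 0 := by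
      rw [← hk, sub_ne_zero]
      exact_mod_cast (hn.ne hij).symm
    have h0 : (1 : ℝ) ≤ ‖(k : ℂ)‖ := by
      rw [Complex.norm_intCast]
      exact_mod_cast Int.one_le_abs hk0
    have h1 : φ (3 * n j - 3 * n i : R) = 3 * (k : ℂ) := by
      rw [← hk]
      push_cast
      rw [map_sub, map_mul, map_mul, map_natCast, map_natCast, map_ofNat]
      ring
    rw [h1, norm_mul, Complex.norm_ofNat]
    linarith
  · rintro i _ ⟨g, hg, rfl⟩ hgZ x hx
    have hgZ' : g ∉ Subgroup.center SL(2, R) := fun h =>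
      hgZ (Subgroup.Normal.conj_mem inferInstance g h _)
    have := (hB i g hg).resolve_left hgZ' _ (not_not.1 hx)
    simpa [mul_assoc] using this

end ColumnBall

section Shortest

variable {R : Type*} [CommRing R] {φ : R →+* ℂ}

theorem one_le_norm_of_sq_eq_natCast (hφ : Function.Injective φ)
    (hnorm : ∀ x, ∃ m : ℕ, ‖φ x‖ ^ 2 = m) {x : R} (hx : x ≠ 0) : 1 ≤ ‖φ x‖ := by
  obtain ⟨m, hm⟩ := hnorm x
  have h0 : 0 < ‖φ x‖ := norm_pos_iff.2 ((map_ne_zero_iff φ hφ).2 hx)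
  have hm0 : 0 < m := by
    have : (0 : ℝ) < m := hm ▸ pow_pos h0 2
    exact_mod_cast this
  rw [← one_le_sq_iff₀ (norm_nonneg _), hm]
  exact_mod_cast hm0

theorem exists_forall_norm_le_norm_add (hnorm : ∀ x, ∃ m : ℕ, ‖φ x‖ ^ 2 = m) (N s : R) :
    ∃ t x : R, (s = t + N * x ∨ s = -(t + N * x)) ∧ 0 ≤ (φ t).re ∧
      ∀ y, ‖φ t‖ ≤ ‖φ (t + N * y)‖ := by
  choose m hm using hnorm
  obtain ⟨x, hx⟩ : ∃ x, ∀ y, ‖φ (s + N * x)‖ ≤ ‖φ (s + N * y)‖ := by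
    refine ⟨Function.argmin (fun x => m (s + N * x)), fun y => ?_⟩
    rw [← sq_le_sq₀ (norm_nonneg _) (norm_nonneg _), hm, hm, Nat.cast_le]
    exact Function.argmin_le (fun x => m (s + N * x)) y
  rcases le_total 0 (φ (s + N * x)).re with h | h
  · refine ⟨s + N * x, -x, .inl (by ring), h, fun y => ?_⟩
    rw [show s + N * x + N * y = s + N * (x + y) by ring]
    exact hx _
  · refine ⟨-(s + N * x), x, .inr (by ring),
      by simpa only [map_neg, Complex.neg_re, neg_nonneg] using h, fun y => ?_⟩
    rw [show -(s + N * x) + N * y = -(s + N * (x - y)) by ring, map_neg, map_neg, norm_neg,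
      norm_neg]
    exact hx _

theorem six_le_norm_of_forall_norm_le (hφ : ∀ x : R, x ≠ 0 → 1 ≤ ‖φ x‖) {t : R}
    (ht : ∀ y, ‖φ t‖ ≤ ‖φ (t + 20 * y)‖) :
    ∀ a ∈ ({0, t, -4} : Set R), ∀ b ∈ ({0, t, -4} : Set R), ∀ y ≠ 0,
      6 ≤ ‖φ (20 * y) + φ a - φ b‖ := by
  intro a ha b hb y hy
  have h20 : 20 ≤ ‖φ (20 * y)‖ := by
    rw [map_mul, map_ofNat, norm_mul, Complex.norm_ofNat]
    linarith [hφ y hy]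
  have h4 : φ (-4) = -4 := by rw [map_neg, map_ofNat]
  have hn4 : ‖(4 : ℂ)‖ = 4 := Complex.norm_ofNat 4
  have h1 : 10 ≤ ‖φ (20 * y) + φ t‖ := by
    have h := ht y
    have h' := norm_sub_le (φ (20 * y) + φ t) (φ t)
    rw [map_add, add_comm] at h
    rw [add_sub_cancel_right] at h'
    linarith
  have h2 : 10 ≤ ‖φ (20 * y) - φ t‖ := by
    have h := ht (-y)
    have h' := norm_add_le (φ (20 * y) - φ t) (φ t)
    rw [mul_neg, map_add, map_neg, ← sub_eq_add_neg, norm_sub_rev] at h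
    rw [sub_add_cancel] at h'
    linarith
  have h3 : ∀ z : ℂ, 10 ≤ ‖z‖ → 6 ≤ ‖z + 4‖ ∧ 6 ≤ ‖z - 4‖ := by
    intro z hz
    have h := norm_sub_le (z + 4) 4
    have h' := norm_add_le (z - 4) 4
    rw [add_sub_cancel_right] at h
    rw [sub_add_cancel] at h'
    constructor <;> linarith
  rcases ha with rfl | rfl | rfl <;> rcases hb with rfl | rfl | rfl <;>
    simp only [add_sub_cancel_right, map_zero, add_zero, sub_zero, h4, sub_neg_eq_add,
      ← sub_eq_add_neg]
  · linarith
  · linarith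
  · exact (h3 _ (by linarith)).1
  · linarith
  · linarith
  · exact (h3 _ h1).1
  · exact (h3 _ (by linarith)).2
  · rw [sub_right_comm]
    exact (h3 _ h2).2
  · rw [sub_add_cancel]
    linarith

end Shortest

theorem traceSetPM_mono {R : Type*} [CommRing R] {G H : Subgroup SL(2, R)} (h : G ≤ H) :
    traceSetPM G ⊆ traceSetPM H :=
  fun _ ⟨g, hg, hgt⟩ => ⟨g, h hg, hgt⟩

theorem exists_fg_index_eq_zero_traceSetPM_eq_univ {R : Type*} [CommRing R] [Module.Finite ℤ R]
    [Finite (R ⧸ Ideal.span {(20 : R)})] {φ : R →+* ℂ} (hφ : Function.Injective φ)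
    (hnorm : ∀ x, ∃ m : ℕ, ‖φ x‖ ^ 2 = m) :
    ∃ H : Subgroup SL(2, R), H.FG ∧ H.index = 0 ∧ traceSetPM H = Set.univ := by
  have h1 : ∀ x : R, x ≠ 0 → 1 ≤ ‖φ x‖ := fun x => one_le_norm_of_sq_eq_natCast hφ hnorm
  have hshort (κ : R ⧸ Ideal.span {(20 : R)}) : ∃ t, (∀ s, Ideal.Quotient.mk _ s = κ →
      ∃ x, s = t + 20 * x ∨ s = -(t + 20 * x)) ∧ 0 ≤ (φ t).re ∧
      ∀ y, ‖φ t‖ ≤ ‖φ (t + 20 * y)‖ := by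
    obtain ⟨s₀, rfl⟩ := Ideal.Quotient.mk_surjective κ
    obtain ⟨t, x, hx, ht⟩ := exists_forall_norm_le_norm_add hnorm 20 s₀
    refine ⟨t, fun s hs => ?_, ht⟩
    rw [Ideal.Quotient.mk_eq_mk_iff_sub_mem, Ideal.mem_span_singleton] at hs
    obtain ⟨y, hy⟩ := hs
    rcases hx with hx | hx
    · exact ⟨x + y, .inl (by linear_combination hy + hx)⟩
    · exact ⟨x - y, .inr (by linear_combination hy + hx)⟩
  choose t htrace hre hmin using hshort
  obtain ⟨n, hn⟩ := Countable.exists_injective_nat (R ⧸ Ideal.span {(20 : R)})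
  let c (κ : R ⧸ Ideal.span {(20 : R)}) : SL(2, R) →* SL(2, R) :=
    (MulAut.conj (unipotentAt (-4) (.ofAdd (3 * n κ : R)))).toMonoidHom
  refine ⟨⨆ κ, (traceClassSubgroup 20 (t κ)).map (c κ), ?_, ?_, ?_⟩
  · exact .iSup _ fun κ => (Subgroup.fg_iff_submonoid_fg _).2
      (((Subgroup.fg_iff_submonoid_fg _).1 (traceClassSubgroup_fg 20 (t κ))).map (c κ))
  · have hB := index_iSup_map_conj_unipotentAt_eq_zero (-4)
      (B := fun κ => pmUpperUnipotent 20 ⊔ Subgroup.centralizer {companionSL (t κ)})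
      (fun κ => (center_le_pmUpperUnipotent 20).trans le_sup_left)
      (fun κ g hg => mem_center_or_mul_notMem_columnBall h1
        (six_le_norm_of_forall_norm_le h1 (hmin κ)) ?_ ?_ hg) hn
    · exact zero_dvd_iff.1 (hB ▸ Subgroup.index_dvd_of_le
        (iSup_mono fun κ => Subgroup.map_mono (traceClassSubgroup_le 20 (t κ))))
    · rw [map_neg, map_ofNat, norm_neg, Complex.norm_ofNat]
    · rw [map_neg, map_ofNat, ← neg_add', norm_neg]
      refine le_trans ?_ (Complex.re_le_norm _)
      simpa using hre κ
  · refine Set.eq_univ_of_forall fun s => ?_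
    obtain ⟨x, hx⟩ := htrace _ s rfl
    obtain ⟨g, hg, hgt⟩ := exists_mem_traceClassSubgroup 20 (t (Ideal.Quotient.mk _ s)) x
    refine ⟨_, Subgroup.mem_iSup_of_mem _ (Subgroup.mem_map_of_mem (c _) hg), ?_⟩
    have htr (u : SL(2, R)) : Matrix.trace ((u * g * u⁻¹ : SL(2, R)) : Matrix (Fin 2) (Fin 2) R) =
        Matrix.trace (g : Matrix (Fin 2) (Fin 2) R) := by
      have h : u⁻¹ * (u * g) = g := inv_mul_cancel_left u g
      rw [Matrix.SpecialLinearGroup.coe_mul, Matrix.trace_mul_comm,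
        ← Matrix.SpecialLinearGroup.coe_mul, h]
    refine hx.imp (fun h => ?_) (fun h => ?_)
    · exact (htr _).trans (hgt.trans h.symm)
    · exact (htr _).trans (hgt.trans (neg_eq_iff_eq_neg.2 h).symm)

section ImaginaryQuadratic

variable {K : Type*} [Field K] [NumberField K]

theorem exists_rat_add_rat_mul {α : K} {D : ℚ} (hα : α ^ 2 = D)
    (hgen : Algebra.adjoin ℚ {α} = ⊤) (x : K) : ∃ a b : ℚ, x = a + b * α := by
  have hx : x ∈ Algebra.adjoin ℚ {α} := hgen ▸ Algebra.mem_top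
  induction hx using Algebra.adjoin_induction with
  | mem x hx => exact ⟨0, 1, by simpa using hx⟩
  | algebraMap r => exact ⟨r, 0, by simp⟩
  | add x y _ _ hx hy =>
    obtain ⟨a, b, rfl⟩ := hx
    obtain ⟨a', b', rfl⟩ := hy
    exact ⟨a + a', b + b', by push_cast; ring⟩
  | mul x y _ _ hx hy =>
    obtain ⟨a, b, rfl⟩ := hx
    obtain ⟨a', b', rfl⟩ := hy
    exact ⟨a * a' + b * b' * D, a * b' + b * a', by
      push_cast; linear_combination (b * b' : K) * hα⟩

theorem exists_norm_sq_eq_natCast {d : ℕ} (hd : 0 < d) {α : K} (hα : α ^ 2 = -(d : K))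
    (hgen : Algebra.adjoin ℚ {α} = ⊤) (φ : K →+* ℂ) (x : 𝓞 K) : ∃ m : ℕ, ‖φ x‖ ^ 2 = m := by
  obtain ⟨a, b, hab⟩ := exists_rat_add_rat_mul (D := -d) (by simpa using hα) hgen (x : K)
  have hφα : φ α ^ 2 = -(d : ℂ) := by simpa using congrArg φ hα
  obtain ⟨q, hq⟩ : ∃ q : ℚ, q = a ^ 2 + d * b ^ 2 := ⟨_, rfl⟩
  have hre : (φ α).re = 0 := by
    have h := congrArg Complex.im hφα
    have h' := congrArg Complex.re hφα
    simp [pow_two] at h h'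
    have hd' : (0 : ℝ) < d := by exact_mod_cast hd
    by_contra h0
    have : (φ α).im = 0 := by
      refine (mul_eq_zero.1 (?_ : (φ α).re * (φ α).im = 0)).resolve_left h0
      linarith
    rw [this] at h'
    nlinarith [sq_nonneg (φ α).re]
  have hconj : starRingEnd ℂ (φ α) = -φ α := by
    apply Complex.ext <;> simp [hre]
  have hφx : starRingEnd ℂ (φ x) * φ x = q := by
    rw [hab, hq]
    simp only [map_add, map_mul, map_ratCast, hconj]
    push_cast
    linear_combination (-(b : ℂ) ^ 2) * hφα
  have hint : IsIntegral ℤ q := by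
    have hx : IsIntegral ℤ (φ x) := (RingOfIntegers.isIntegral_coe x).map φ.toIntAlgHom
    have hx' : IsIntegral ℤ (starRingEnd ℂ (φ x)) := hx.map (starRingEnd ℂ).toIntAlgHom
    refine (isIntegral_algHom_iff (algebraMap ℚ ℂ).toIntAlgHom (algebraMap ℚ ℂ).injective).1 ?_
    simpa [hφx] using hx'.mul hx
  obtain ⟨k, rfl⟩ := IsIntegrallyClosed.isIntegral_iff.1 hint
  have hk : ‖φ x‖ ^ 2 = (k : ℝ) := by
    rw [Complex.conj_mul'] at hφx
    exact_mod_cast hφx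
  have hk0 : 0 ≤ k := by
    have : (0 : ℝ) ≤ k := hk ▸ sq_nonneg _
    exact_mod_cast this
  lift k to ℕ using hk0
  exact ⟨k, by simpa using hk⟩

end ImaginaryQuadratic

/-- For `K = ℚ(√-d)` an imaginary quadratic field with ring of integers `𝓞`, there is a
finitely generated subgroup of `SL(2, 𝓞)` of infinite index with the same trace set up to
sign as `SL(2, 𝓞)` itself. -/
theorem exists_fg_infinite_index_subgroup_bianchi_trace_set
    (d : ℕ) (hd : Squarefree d) (hd0 : 0 < d)
    (K : Type*) [Field K] [NumberField K] (α : K) (hα : α ^ 2 = -(d : K))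
    (hgen : Algebra.adjoin ℚ {α} = ⊤) :
    ∃ H : Subgroup (Matrix.SpecialLinearGroup (Fin 2) (𝓞 K)), H.FG ∧ H.index = 0 ∧
      traceSetPM H = traceSetPM (⊤ : Subgroup (Matrix.SpecialLinearGroup (Fin 2) (𝓞 K))) := by
  obtain ⟨φ⟩ : Nonempty (K →+* ℂ) := inferInstance
  have : Finite (𝓞 K ⧸ Ideal.span {(20 : 𝓞 K)}) :=
    Ideal.finiteQuotientOfFreeOfNeBot _ (by simp)
  obtain ⟨H, hfg, hindex, htrace⟩ := exists_fg_index_eq_zero_traceSetPM_eq_univ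
    (φ := φ.comp (algebraMap (𝓞 K) K)) (φ.injective.comp RingOfIntegers.coe_injective)
    (exists_norm_sq_eq_natCast hd0 hα hgen φ)
  exact ⟨H, hfg, hindex, (traceSetPM_mono le_top).antisymm (htrace ▸ Set.subset_univ _)⟩
end
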